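/- arXiv:1005.2442 — 5 statements merged into one kernel-verified Lean document; each statement's English description precedes it below -/
import Mathlib

section
/- Let A = diag(λ₁,…,λ_n) with |λ₁| ≥ … ≥ |λ_n| > 1 (all eigenvalues unstable), let C ∈ ℂ^{m×n} with (C,A) detectable, and assume the system is non-degenerate: for every equi-modulus index set I = {j : |λ_j| = r} the submatrix C_I of the columns of C indexed by I has rank |I|. Let Q, R, Σ₀ be Hermitian positive definite, let (γ_k) be i.i.d. Bernoulli with P(γ_k = 1) = p, and let P_k be the associated Riccati recursion. Then the critical value is p_c = 1 − |λ₁|^{−2}: if p > 1 − |λ₁|^{−2} then sup_k E[P_k] is bounded for every initial condition, and if p < 1 − |λ₁|^{−2} then sup_k E[P_k] is unbounded for some initial condition. -/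
open Matrix MeasureTheory ProbabilityTheory
open scoped ComplexOrder ENNReal

/-- One step of the lossy Riccati recursion:
`X ↦ A X Aᴴ + Q − γ · A X Cᴴ (C X Cᴴ + R)⁻¹ C X Aᴴ`. -/
noncomputable def riccStep {ι κ : Type} [Fintype ι] [Fintype κ] [DecidableEq ι] [DecidableEq κ]
    (A : Matrix ι ι ℂ) (C : Matrix κ ι ℂ)
    (Q : Matrix ι ι ℂ) (R : Matrix κ κ ℂ) (g : ℝ)
    (X : Matrix ι ι ℂ) : Matrix ι ι ℂ :=
  A * X * Aᴴ + Q - (g : ℂ) • (A * X * Cᴴ * (C * X * Cᴴ + R)⁻¹ * (C * X * Aᴴ))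

/-- The lossy Riccati recursion `P₀ = S0`, `P_{k+1} = riccStep (γ k) (P k)`. -/
noncomputable def ricc {ι κ : Type} [Fintype ι] [Fintype κ] [DecidableEq ι] [DecidableEq κ]
    (A : Matrix ι ι ℂ) (C : Matrix κ ι ℂ)
    (Q : Matrix ι ι ℂ) (R : Matrix κ κ ℂ) (S0 : Matrix ι ι ℂ) (γ : ℕ → ℝ) :
    ℕ → Matrix ι ι ℂ
  | 0 => S0
  | k + 1 => riccStep A C Q R (γ k) (ricc A C Q R S0 γ k)

/-- Loewner order: `X ≤ Y` iff `Y - X` is positive semidefinite. -/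
def loe {ι : Type} [Fintype ι] (X Y : Matrix ι ι ℂ) : Prop := (Y - X).PosSemidef

/-- Entrywise expectation of a random matrix. -/
noncomputable def matExp {Ω ι κ : Type} [MeasurableSpace Ω] (μ : Measure Ω)
    (X : Ω → Matrix ι κ ℂ) : Matrix ι κ ℂ :=
  Matrix.of fun i j => ∫ ω, X ω i j ∂μ

/-- `sup_k E[P_k]` is bounded: the entries are integrable and there is a Hermitian matrix `M`
dominating every `E[P_k]` in the Loewner order. -/
def EBounded {Ω ι : Type} [Fintype ι] [MeasurableSpace Ω] (μ : Measure Ω)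
    (P : ℕ → Ω → Matrix ι ι ℂ) : Prop :=
  (∀ k i j, Integrable (fun ω => P k ω i j) μ) ∧
  ∃ M : Matrix ι ι ℂ, M.IsHermitian ∧ ∀ k, loe (matExp μ (P k)) M

/-- PBH detectability of `(C, A)`. -/
def Detectable {ι κ : Type} [Fintype ι] [Fintype κ] [DecidableEq ι]
    (A : Matrix ι ι ℂ) (C : Matrix κ ι ℂ) : Prop :=
  ∀ z : ℂ, 1 ≤ ‖z‖ →
    (Matrix.fromRows (A - z • (1 : Matrix ι ι ℂ)) C).rank = Fintype.card ι

/-- Non-degeneracy: for each equi-modulus index set `{j | |d j| = r}` the corresponding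
columns of `C` are linearly independent (i.e. `rank C_I = |I|`). -/
def NonDeg {ι κ : Type} (d : ι → ℂ) (C : Matrix κ ι ℂ) : Prop :=
  ∀ r : ℝ, LinearIndependent ℂ
    (fun j : {j : ι // ‖d j‖ = r} => fun i : κ => C i j.1)

section helpers
open scoped MatrixOrder

lemma aux_congr {ι : Type} [Fintype ι] {M N : Matrix ι ι ℂ} (hN : N.PosSemidef) (h : M = N) :
    M.PosSemidef := h ▸ hN

lemma aux_joseph {ι κ : Type} [Fintype ι] [Fintype κ] [DecidableEq ι] [DecidableEq κ]
    (C : Matrix κ ι ℂ) (P : Matrix ι ι ℂ) (R : Matrix κ κ ℂ) (hP : P.PosSemidef) (hR : R.PosDef)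
    (V : Matrix ι ι ℂ) (U : Matrix κ ι ℂ) :
    Vᴴ * (P - P * Cᴴ * (C * P * Cᴴ + R)⁻¹ * (C * P)) * V
      + (U - (C * P * Cᴴ + R)⁻¹ * (C * P * V))ᴴ * (C * P * Cᴴ + R)
        * (U - (C * P * Cᴴ + R)⁻¹ * (C * P * V))
      = (V - Cᴴ * U)ᴴ * P * (V - Cᴴ * U) + Uᴴ * R * U := by
  have hS : (C * P * Cᴴ + R).PosDef := by
    have := hP.mul_mul_conjTranspose_same C
    exact Matrix.PosDef.posSemidef_add this hR
  have hu : IsUnit (C * P * Cᴴ + R).det := hS.isUnit.map Matrix.detMonoidHom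
  have hSR : R = (C * P * Cᴴ + R) - C * P * Cᴴ := by simp
  have hRr : Uᴴ * R * U = Uᴴ * ((C * P * Cᴴ + R) - C * P * Cᴴ) * U := by rw [← hSR]
  rw [hRr]
  generalize hSS : C * P * Cᴴ + R = S at *
  have h1 : S⁻¹ * S = 1 := Matrix.nonsing_inv_mul _ hu
  have h2 : S * S⁻¹ = 1 := Matrix.mul_nonsing_inv _ hu
  have hPh : Pᴴ = P := hP.1
  have hSh : (S⁻¹)ᴴ = S⁻¹ := hS.1.inv
  have e1 : (C * P * V)ᴴ = Vᴴ * P * Cᴴ := by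
    simp [Matrix.conjTranspose_mul, hPh, Matrix.mul_assoc]
  have e2 : (U - S⁻¹ * (C * P * V))ᴴ * S * (U - S⁻¹ * (C * P * V))
      = Uᴴ * S * U - Uᴴ * (C * P * V) - (C * P * V)ᴴ * U
        + (C * P * V)ᴴ * S⁻¹ * (C * P * V) := by
    rw [Matrix.conjTranspose_sub, Matrix.conjTranspose_mul, hSh]
    generalize C * P * V = W
    have h3 : S * (S⁻¹ * W) = W := by rw [← Matrix.mul_assoc, h2, Matrix.one_mul]
    have h4 : Wᴴ * S⁻¹ * S = Wᴴ := by rw [Matrix.mul_assoc, h1, Matrix.mul_one]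
    rw [Matrix.sub_mul, h4, Matrix.mul_sub, Matrix.sub_mul, Matrix.sub_mul,
      Matrix.mul_assoc Uᴴ S (S⁻¹ * W), h3, ← Matrix.mul_assoc Wᴴ]
    abel
  rw [e2, e1, Matrix.conjTranspose_sub, Matrix.conjTranspose_mul, Matrix.conjTranspose_conjTranspose]
  simp only [Matrix.mul_sub, Matrix.sub_mul, Matrix.mul_assoc]
  abel

lemma aux_post_psd {ι κ : Type} [Fintype ι] [Fintype κ] [DecidableEq ι] [DecidableEq κ]
    (C : Matrix κ ι ℂ) (P : Matrix ι ι ℂ) (R : Matrix κ κ ℂ) (hP : P.PosSemidef) (hR : R.PosDef) :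
    (P - P * Cᴴ * (C * P * Cᴴ + R)⁻¹ * (C * P)).PosSemidef := by
  have h := aux_joseph C P R hP hR (1 : Matrix ι ι ℂ) ((C * P * Cᴴ + R)⁻¹ * (C * P * (1 : Matrix ι ι ℂ)))
  simp only [sub_self, Matrix.mul_zero, add_zero, Matrix.conjTranspose_one, Matrix.one_mul,
    Matrix.mul_one] at h
  rw [h]
  exact (hP.conjTranspose_mul_mul_same _).add (hR.posSemidef.conjTranspose_mul_mul_same _)

lemma aux_post_le {ι κ : Type} [Fintype ι] [Fintype κ] [DecidableEq ι] [DecidableEq κ]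
    (C : Matrix κ ι ℂ) (P : Matrix ι ι ℂ) (R : Matrix κ κ ℂ) (hP : P.PosSemidef) (hR : R.PosDef)
    (V : Matrix ι ι ℂ) (U : Matrix κ ι ℂ) :
    Vᴴ * (P - P * Cᴴ * (C * P * Cᴴ + R)⁻¹ * (C * P)) * V ≤
      (V - Cᴴ * U)ᴴ * P * (V - Cᴴ * U) + Uᴴ * R * U := by
  rw [← aux_joseph C P R hP hR V U, Matrix.le_iff, add_sub_cancel_left]
  have hS : (C * P * Cᴴ + R).PosDef := 
    Matrix.PosDef.posSemidef_add (hP.mul_mul_conjTranspose_same C) hR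
  exact hS.posSemidef.conjTranspose_mul_mul_same _

lemma aux_step_one {ι κ : Type} [Fintype ι] [Fintype κ] [DecidableEq ι] [DecidableEq κ]
    (A : Matrix ι ι ℂ) (C : Matrix κ ι ℂ)
    (Q : Matrix ι ι ℂ) (R : Matrix κ κ ℂ) (P : Matrix ι ι ℂ) :
    riccStep A C Q R 1 P = A * (P - P * Cᴴ * (C * P * Cᴴ + R)⁻¹ * (C * P)) * Aᴴ + Q := by
  simp only [riccStep, Complex.ofReal_one, one_smul, Matrix.mul_sub, Matrix.sub_mul,
    Matrix.mul_assoc]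
  abel

lemma aux_step_zero {ι κ : Type} [Fintype ι] [Fintype κ] [DecidableEq ι] [DecidableEq κ]
    (A : Matrix ι ι ℂ) (C : Matrix κ ι ℂ)
    (Q : Matrix ι ι ℂ) (R : Matrix κ κ ℂ) (P : Matrix ι ι ℂ) :
    riccStep A C Q R 0 P = A * P * Aᴴ + Q := by
  simp [riccStep]

lemma aux_step_psd {ι κ : Type} [Fintype ι] [Fintype κ] [DecidableEq ι] [DecidableEq κ]
    (A : Matrix ι ι ℂ) (C : Matrix κ ι ℂ)
    (Q : Matrix ι ι ℂ) (R : Matrix κ κ ℂ) (hQ : Q.PosDef) (hR : R.PosDef) (g : ℝ)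
    (hg : g = 0 ∨ g = 1) (P : Matrix ι ι ℂ) (hP : P.PosSemidef) :
    (riccStep A C Q R g P).PosSemidef := by
  rcases hg with rfl | rfl
  · rw [aux_step_zero]
    exact (hP.mul_mul_conjTranspose_same A).add hQ.posSemidef
  · rw [aux_step_one]
    exact ((aux_post_psd C P R hP hR).mul_mul_conjTranspose_same A).add hQ.posSemidef

lemma aux_ricc_psd {ι κ : Type} [Fintype ι] [Fintype κ] [DecidableEq ι] [DecidableEq κ]
    (A : Matrix ι ι ℂ) (C : Matrix κ ι ℂ)
    (Q : Matrix ι ι ℂ) (R : Matrix κ κ ℂ) (hQ : Q.PosDef) (hR : R.PosDef)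
    (S0 : Matrix ι ι ℂ) (h0 : S0.PosSemidef) (γ : ℕ → ℝ)
    (hg : ∀ i, γ i = 0 ∨ γ i = 1) (k : ℕ) :
    (ricc A C Q R S0 γ k).PosSemidef := by
  induction k with
  | zero => exact h0
  | succ k ih => exact aux_step_psd A C Q R hQ hR _ (hg k) _ ih

open scoped Matrix.Norms.L2Operator in
/-- every Hermitian matrix is bounded by a multiple of the identity -/
lemma aux_le_smul {ι : Type} [Fintype ι] [DecidableEq ι] (M : Matrix ι ι ℂ) (hM : M.IsHermitian) :
    ∃ c : ℝ, 0 < c ∧ M ≤ (c : ℂ) • (1 : Matrix ι ι ℂ) := by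
  have h : IsSelfAdjoint M := hM
  have h1 := h.le_algebraMap_norm_self
  refine ⟨‖M‖ + 1, by positivity, h1.trans ?_⟩
  rw [Matrix.le_iff, Algebra.algebraMap_eq_smul_one]
  have : (((‖M‖ + 1 : ℝ) : ℂ) • (1 : Matrix ι ι ℂ) - ‖M‖ • (1 : Matrix ι ι ℂ)) = 1 := by
    rw [← Complex.coe_smul, ← sub_smul]; simp
  rw [this]
  exact Matrix.PosSemidef.one

lemma aux_sq_le {ι : Type} [Fintype ι] [DecidableEq ι] (X : Matrix ι ι ℂ) (hX : X.PosSemidef)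
    (c : ℝ) (h : X ≤ (c : ℂ) • (1 : Matrix ι ι ℂ)) : X * X ≤ (c : ℂ) • X := by
  have hS := CFC.sqrt_mul_sqrt_self X hX.nonneg
  have hSh : (CFC.sqrt X)ᴴ = CFC.sqrt X := (CFC.sqrt_nonneg X).posSemidef.1
  rw [Matrix.le_iff] at h ⊢
  have := h.conjTranspose_mul_mul_same (CFC.sqrt X)
  rw [hSh] at this
  refine aux_congr (this) ?_
  generalize CFC.sqrt X = S at *
  rw [← hS]
  simp only [Matrix.mul_sub, Matrix.sub_mul, Matrix.mul_assoc, Matrix.smul_mul, Matrix.mul_smul, Matrix.one_mul]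

lemma aux_inv_bound {ι : Type} [Fintype ι] [DecidableEq ι] (X P : Matrix ι ι ℂ)
    (κ : ℝ) (hκ : 0 < κ) (hX : (κ : ℂ) • (1 : Matrix ι ι ℂ) ≤ X) (hP : X * P * X ≤ X) :
    P ≤ ((κ⁻¹ : ℝ) : ℂ) • (1 : Matrix ι ι ℂ) := by
  have hκ' : (0 : ℂ) < κ := by exact_mod_cast hκ
  have hpd : X.PosDef := by
    have h1 : ((κ : ℂ) • (1 : Matrix ι ι ℂ)).PosDef := Matrix.PosDef.one.smul hκ'
    have := Matrix.PosDef.posSemidef_add (Matrix.le_iff.1 hX) h1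
    simpa using this
  have hu : IsUnit X.det := hpd.isUnit.map Matrix.detMonoidHom
  have hYh : (X⁻¹)ᴴ = X⁻¹ := hpd.1.inv
  have h1 : X⁻¹ * X = 1 := Matrix.nonsing_inv_mul _ hu
  have h2 : X * X⁻¹ = 1 := Matrix.mul_nonsing_inv _ hu
  have a1 := (Matrix.le_iff.1 hP).conjTranspose_mul_mul_same X⁻¹
  have a2 := (Matrix.le_iff.1 hX).conjTranspose_mul_mul_same X⁻¹
  rw [hYh] at a1 a2
  generalize X⁻¹ = Y at *
  have e1 : Y * (X - X * P * X) * Y = Y - P := by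
    calc Y * (X - X * P * X) * Y = (Y * X) * Y - (Y * X) * P * (X * Y) := by noncomm_ring
      _ = _ := by rw [h1, h2]; simp
  have e2 : Y * (X - (κ : ℂ) • (1 : Matrix ι ι ℂ)) * Y = Y - (κ : ℂ) • (Y * Y) := by
    calc Y * (X - (κ : ℂ) • (1 : Matrix ι ι ℂ)) * Y = (Y * X) * Y - (κ : ℂ) • (Y * Y) := by
          simp [Matrix.mul_sub, Matrix.sub_mul]
      _ = _ := by rw [h1]; simp
  rw [e1] at a1
  rw [e2] at a2
  have a3 : ((1 - (κ : ℂ) • Y)ᴴ * (1 - (κ : ℂ) • Y)).PosSemidef :=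
    Matrix.posSemidef_conjTranspose_mul_self _
  have hκi : (0 : ℂ) ≤ ((κ⁻¹ : ℝ) : ℂ) := by exact_mod_cast (inv_pos.2 hκ).le
  have a4 := (a1.add a2).add (a3.smul hκi)
  rw [Matrix.le_iff]
  refine aux_congr (a4) ?_
  rw [Matrix.conjTranspose_sub, Matrix.conjTranspose_smul, hYh]
  have hne : (κ : ℂ) ≠ 0 := hκ'.ne'
  simp only [Matrix.conjTranspose_one, Matrix.mul_sub, Matrix.sub_mul, Matrix.one_mul,
    Matrix.mul_one, Matrix.smul_mul, Matrix.mul_smul, smul_sub, smul_smul, Complex.ofReal_inv,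
    Complex.star_def, Complex.conj_ofReal, inv_mul_cancel₀ hne, inv_mul_cancel_left₀ hne, one_smul]
  abel

/-- suboptimal information matrix -/
noncomputable def infoX {ι κ : Type} [Fintype ι] [Fintype κ] [DecidableEq ι]
    (D : Matrix ι ι ℂ) (C : Matrix κ ι ℂ) (ε β : ℝ) (γ : ℕ → ℝ) : ℕ → Matrix ι ι ℂ
  | 0 => (ε : ℂ) • 1
  | k + 1 => (β : ℂ) • (Dᴴ * (infoX D C ε β γ k + ((γ k * ε : ℝ) : ℂ) • (Cᴴ * C)) * D)

lemma aux_meas {ι κ : Type} [Fintype ι] [Fintype κ] [DecidableEq ι] [DecidableEq κ]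
    (A D : Matrix ι ι ℂ) (C : Matrix κ ι ℂ)
    (Q : Matrix ι ι ℂ) (R : Matrix κ κ ℂ) (hR : R.PosDef) (g : ℝ)
    (hg : g = 0 ∨ g = 1) (P X : Matrix ι ι ℂ) (hP : P.PosSemidef) (hX : X.PosSemidef)
    (h : X * P * X ≤ X) (ε r : ℝ) (hε : 0 < ε) (hr : R ≤ (r : ℂ) • (1 : Matrix κ κ ℂ))
    (her : ε * r ≤ 1) :
    ∃ N : Matrix ι ι ℂ, riccStep A C Q R g P = A * N * Aᴴ + Q ∧
      (X + ((g * ε : ℝ) : ℂ) • (Cᴴ * C)) * N * (X + ((g * ε : ℝ) : ℂ) • (Cᴴ * C)) ≤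
        X + ((g * ε : ℝ) : ℂ) • (Cᴴ * C) := by
  rcases hg with rfl | rfl
  · exact ⟨P, aux_step_zero .., by simpa using h⟩
  · refine ⟨_, aux_step_one .., ?_⟩
    rw [one_mul]
    have hXh : Xᴴ = X := hX.1
    have hh : (X + (ε : ℂ) • (Cᴴ * C))ᴴ = X + (ε : ℂ) • (Cᴴ * C) := by
      simp [Matrix.conjTranspose_add, Matrix.conjTranspose_smul, Matrix.conjTranspose_mul, hXh]
    have h1 := aux_post_le C P R hP hR (X + (ε : ℂ) • (Cᴴ * C)) ((ε : ℂ) • C)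
    rw [hh] at h1
    have e : X + (ε : ℂ) • (Cᴴ * C) - Cᴴ * ((ε : ℂ) • C) = X := by simp
    rw [e, hXh] at h1
    refine h1.trans (add_le_add h ?_)
    have h2 := (Matrix.le_iff.1 hr).conjTranspose_mul_mul_same C
    have h3 : (0 : ℂ) ≤ ((ε ^ 2 : ℝ) : ℂ) := by exact_mod_cast (sq_nonneg ε)
    have h4 : (0 : ℂ) ≤ ((ε - ε ^ 2 * r : ℝ) : ℂ) := by
      have : 0 ≤ ε - ε ^ 2 * r := by nlinarith
      exact_mod_cast this
    have h5 := (h2.smul h3).add ((Matrix.posSemidef_conjTranspose_mul_self C).smul h4)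
    rw [Matrix.le_iff]
    refine aux_congr (h5) ?_
    simp only [Matrix.mul_sub, Matrix.sub_mul, Matrix.mul_one, Matrix.conjTranspose_smul,
      Matrix.smul_mul, Matrix.mul_smul, smul_sub, smul_smul,
      Complex.star_def, Complex.conj_ofReal, Complex.ofReal_sub, Complex.ofReal_mul,
      Complex.ofReal_pow, sub_smul, sq]
    abel

lemma aux_time {ι : Type} [Fintype ι] [DecidableEq ι]
    (A D Q N X : Matrix ι ι ℂ) (hDA : D * A = 1) (hX : X.PosSemidef)
    (h : X * N * X ≤ X) (δ c q : ℝ) (hδ : 0 < δ) (hq0 : 0 ≤ q)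
    (hq : D * Q * Dᴴ ≤ (q : ℂ) • (1 : Matrix ι ι ℂ)) (hc : X ≤ (c : ℂ) • (1 : Matrix ι ι ℂ))
    (hqc : q * c ≤ δ) :
    let Y := (((1 + δ)⁻¹ : ℝ) : ℂ) • (Dᴴ * X * D)
    Y * (A * N * Aᴴ + Q) * Y ≤ Y := by
  intro Y
  have hXh : Xᴴ = X := hX.1
  have hAD : Aᴴ * Dᴴ = 1 := by rw [← Matrix.conjTranspose_mul, hDA, Matrix.conjTranspose_one]
  have h1 := (Matrix.le_iff.1 hq).conjTranspose_mul_mul_same X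
  rw [hXh] at h1
  have h2 := Matrix.le_iff.1 (aux_sq_le X hX c hc)
  have hq0' : (0 : ℂ) ≤ (q : ℂ) := by exact_mod_cast hq0
  have h3 : (0 : ℂ) ≤ ((δ - q * c : ℝ) : ℂ) := by
    have : 0 ≤ δ - q * c := by linarith
    exact_mod_cast this
  have h4 : ((δ : ℂ) • X - X * (D * Q * Dᴴ) * X).PosSemidef := by
    have h5 := (h1.add (h2.smul hq0')).add (hX.smul h3)
    refine aux_congr (h5) ?_
    simp only [Matrix.mul_sub, Matrix.sub_mul, Matrix.mul_one, 
      Matrix.smul_mul, Matrix.mul_smul, smul_sub, smul_smul,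
      Complex.ofReal_sub, Complex.ofReal_mul, sub_smul]
    abel
  have h5 := ((Matrix.le_iff.1 h).add h4).conjTranspose_mul_mul_same D
  have hb : (0 : ℂ) ≤ (((1 + δ)⁻¹ ^ 2 : ℝ) : ℂ) := by
    have : 0 ≤ (1 + δ)⁻¹ ^ 2 := by positivity
    exact_mod_cast this
  have h6 := h5.smul hb
  rw [Matrix.le_iff]
  refine aux_congr (h6) ?_
  have e1 : Y * (A * N * Aᴴ + Q) * Y = (((1 + δ)⁻¹ ^ 2 : ℝ) : ℂ) •
      (Dᴴ * (X * N * X + X * (D * Q * Dᴴ) * X) * D) := by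
    have e2 : (Dᴴ * X * D) * (A * N * Aᴴ + Q) * (Dᴴ * X * D) =
        Dᴴ * (X * N * X + X * (D * Q * Dᴴ) * X) * D := by
      calc _ = Dᴴ * X * (D * A) * N * (Aᴴ * Dᴴ) * X * D + Dᴴ * (X * (D * Q * Dᴴ) * X) * D := by
            noncomm_ring
        _ = _ := by rw [hDA, hAD]; noncomm_ring
    simp only [Y, Matrix.smul_mul, Matrix.mul_smul, smul_smul]
    rw [e2]; push_cast; rw [sq]
  have e3 : Y = (((1 + δ)⁻¹ ^ 2 : ℝ) : ℂ) • (Dᴴ * (X + (δ : ℂ) • X) * D) := by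
    have : X + (δ : ℂ) • X = ((1 + δ : ℝ) : ℂ) • X := by
      push_cast; rw [add_smul, one_smul]
    rw [this]
    simp only [Y, Matrix.smul_mul, Matrix.mul_smul, smul_smul, ← Complex.ofReal_mul]
    congr 2
    field_simp
  rw [e1]
  nth_rw 1 [e3]
  rw [← smul_sub, ← Matrix.sub_mul, ← Matrix.mul_sub]
  congr 3
  abel_nf

lemma aux_info {ι κ : Type} [Fintype ι] [Fintype κ] [DecidableEq ι] [DecidableEq κ]
    (A D : Matrix ι ι ℂ) (C : Matrix κ ι ℂ)
    (Q : Matrix ι ι ℂ) (R : Matrix κ κ ℂ) (hQ : Q.PosDef) (hR : R.PosDef)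
    (S0 : Matrix ι ι ℂ) (h0 : S0.PosSemidef) (hDA : D * A = 1)
    (hD : Dᴴ * D ≤ 1) (δ : ℝ) (hδ : 0 < δ) :
    ∃ ε : ℝ, 0 < ε ∧ ∀ γ : ℕ → ℝ, (∀ i, γ i = 0 ∨ γ i = 1) → ∀ k,
      infoX D C ε (1 + δ)⁻¹ γ k * ricc A C Q R S0 γ k * infoX D C ε (1 + δ)⁻¹ γ k
        ≤ infoX D C ε (1 + δ)⁻¹ γ k := by
  obtain ⟨q, hq0, hq⟩ := aux_le_smul (D * Q * Dᴴ)
    (hQ.posSemidef.mul_mul_conjTranspose_same D).1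
  obtain ⟨K, hK0, hK⟩ := aux_le_smul (Cᴴ * C) (Matrix.posSemidef_conjTranspose_mul_self C).1
  obtain ⟨r, hr0, hr⟩ := aux_le_smul R hR.1
  obtain ⟨s, hs0, hs⟩ := aux_le_smul S0 h0.1
  set c : ℝ := δ / ((1 + δ) * q) with hc
  have hc0 : 0 < c := by positivity
  set ε : ℝ := min (min c (δ * c / K)) (min r⁻¹ s⁻¹) with hε
  have hε0 : 0 < ε := by
    simp only [hε, lt_min_iff]; refine ⟨⟨hc0, ?_⟩, ?_, ?_⟩ <;> positivity
  have hε1 : ε ≤ c := (min_le_left _ _).trans (min_le_left _ _)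
  have hε2 : ε * K ≤ δ * c := by
    have : ε ≤ δ * c / K := (min_le_left _ _).trans (min_le_right _ _)
    rwa [le_div_iff₀ hK0] at this
  have hε3 : ε * r ≤ 1 := by
    have : ε ≤ r⁻¹ := (min_le_right _ _).trans (min_le_left _ _)
    calc ε * r ≤ r⁻¹ * r := by gcongr
      _ = 1 := by field_simp
  have hε4 : ε * s ≤ 1 := by
    have : ε ≤ s⁻¹ := (min_le_right _ _).trans (min_le_right _ _)
    calc ε * s ≤ s⁻¹ * s := by gcongr
      _ = 1 := by field_simp
  refine ⟨ε, hε0, fun γ hγ k => ?_⟩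
  have psm : ∀ (x : ℝ) (M : Matrix ι ι ℂ), 0 ≤ x → M.PosSemidef → ((x : ℂ) • M).PosSemidef := by
    intro x M hx hM
    have : (0 : ℂ) ≤ x := by exact_mod_cast hx
    exact hM.smul this
  suffices H : (infoX D C ε (1 + δ)⁻¹ γ k).PosSemidef ∧
      infoX D C ε (1 + δ)⁻¹ γ k ≤ (c : ℂ) • 1 ∧ 
      infoX D C ε (1 + δ)⁻¹ γ k * ricc A C Q R S0 γ k * infoX D C ε (1 + δ)⁻¹ γ k
        ≤ infoX D C ε (1 + δ)⁻¹ γ k from H.2.2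
  induction k with
  | zero =>
    simp only [infoX, ricc]
    refine ⟨psm _ _ hε0.le Matrix.PosSemidef.one, ?_, ?_⟩
    · rw [Matrix.le_iff, ← sub_smul, ← Complex.ofReal_sub]
      exact psm _ _ (by linarith) Matrix.PosSemidef.one
    · rw [Matrix.le_iff]
      refine aux_congr ((psm (ε ^ 2) _ (sq_nonneg _) (Matrix.le_iff.1 hs)).add
        (psm (ε - ε ^ 2 * s) _ (by nlinarith) (Matrix.PosSemidef.one))) ?_
      simp only [Matrix.mul_sub, Matrix.sub_mul, Matrix.mul_one, Matrix.one_mul,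
        Matrix.smul_mul, Matrix.mul_smul, smul_sub, smul_smul,
        Complex.ofReal_sub, Complex.ofReal_mul, sub_smul, Complex.ofReal_pow, sq]
      abel
  | succ k ih =>
    obtain ⟨i1, i2, i3⟩ := ih
    have hg0 : 0 ≤ γ k * ε ∧ γ k * ε ≤ ε := by
      rcases hγ k with h | h <;> rw [h] <;> simp [hε0.le]
    have hPk := aux_ricc_psd A C Q R hQ hR S0 h0 γ hγ k
    obtain ⟨N, hN1, hN2⟩ := aux_meas A D C Q R hR (γ k) (hγ k) _ _ hPk i1 i3 ε r hε0 hr hε3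
    set X' := infoX D C ε (1 + δ)⁻¹ γ k + ((γ k * ε : ℝ) : ℂ) • (Cᴴ * C) with hX'
    have hX'p : X'.PosSemidef := i1.add (psm _ _ hg0.1 (Matrix.posSemidef_conjTranspose_mul_self C))
    have hX'c : X' ≤ (((1 + δ) * c : ℝ) : ℂ) • 1 := by
      rw [Matrix.le_iff]
      have hh : γ k * ε * K ≤ δ * c := le_trans (by gcongr; exact hg0.2) hε2
      refine aux_congr (((Matrix.le_iff.1 i2).add (psm (γ k * ε) _ hg0.1 (Matrix.le_iff.1 hK))).add
        (psm (δ * c - γ k * ε * K) _ (by linarith) (Matrix.PosSemidef.one))) ?_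
      rw [hX']
      simp only [smul_sub, smul_smul, add_mul, add_smul,
        Complex.ofReal_sub, Complex.ofReal_mul, Complex.ofReal_add, Complex.ofReal_one, one_mul,
        sub_smul]
      abel
    have hY : infoX D C ε (1 + δ)⁻¹ γ (k + 1) = (((1 + δ)⁻¹ : ℝ) : ℂ) • (Dᴴ * X' * D) := rfl
    have hR' : ricc A C Q R S0 γ (k + 1) = A * N * Aᴴ + Q := hN1
    rw [hY, hR']
    refine ⟨psm _ _ (by positivity) (hX'p.conjTranspose_mul_mul_same D), ?_, ?_⟩
    · rw [Matrix.le_iff]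
      have h1 := (Matrix.le_iff.1 hX'c).conjTranspose_mul_mul_same D
      refine aux_congr ((psm (1 + δ)⁻¹ _ (by positivity) h1).add (psm c _ hc0.le (Matrix.le_iff.1 hD))) ?_
      have : (((1 + δ)⁻¹ : ℝ) : ℂ) * (((1 + δ) * c : ℝ) : ℂ) = c := by
        rw [← Complex.ofReal_mul]; congr 1; field_simp
      simp only [Matrix.mul_sub, Matrix.sub_mul, Matrix.mul_one, Matrix.one_mul,
        Matrix.smul_mul, Matrix.mul_smul, smul_sub, smul_smul, this]
      abel
    · exact aux_time A D Q N X' hDA hX'p hN2 δ ((1 + δ) * c) q hδ hq0.le hq hX'c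
        (by rw [hc]; apply le_of_eq; field_simp)
end helpers

section obs

noncomputable def wt (lam : ℕ → ℝ) (t : ℕ → ℕ) (η : ℝ) : ℕ → ℝ
  | 0 => 1
  | i + 1 => η * (lam (i + 1) / lam i) ^ (t i) * wt lam t η i

lemma wt_pos (lam : ℕ → ℝ) (t : ℕ → ℕ) (η : ℝ) (hl : ∀ i, 0 < lam i) (hη : 0 < η) (i : ℕ) :
    0 < wt lam t η i := by
  induction i with
  | zero => simp [wt]
  | succ i ih =>
    have h1 := hl i
    have h2 := hl (i + 1)
    simp only [wt]; positivity

lemma wt_up (lam : ℕ → ℝ) (t : ℕ → ℕ) (η : ℝ) (hl : ∀ i, 0 < lam i) (hη : 0 < η) (hη1 : η ≤ 1)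
    (hanti : Antitone lam) (ht : Monotone t) (i k : ℕ) :
    wt lam t η (i + 1 + k) ≤ η * (lam (i + 1 + k) / lam i) ^ (t i) * wt lam t η i := by
  induction k with
  | zero => simp [wt]
  | succ k ih =>
    have hw := wt_pos lam t η hl hη
    have h1 : wt lam t η (i + 1 + (k + 1)) =
      η * (lam (i + 1 + k + 1) / lam (i + 1 + k)) ^ (t (i + 1 + k)) * wt lam t η (i + 1 + k) := rfl
    rw [h1]
    have p0 := hl i
    have p1 := hl (i + 1 + k)
    have p2 := hl (i + 1 + k + 1)
    have hr : lam (i + 1 + k + 1) / lam (i + 1 + k) ≤ 1 := by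
      rw [div_le_one p1]; exact hanti (by omega)
    have h2 : (lam (i + 1 + k + 1) / lam (i + 1 + k)) ^ (t (i + 1 + k)) ≤
        (lam (i + 1 + k + 1) / lam (i + 1 + k)) ^ (t i) :=
      pow_le_pow_of_le_one (by positivity) hr (ht (by omega))
    have := hw (i + 1 + k)
    calc _ ≤ 1 * (lam (i + 1 + k + 1) / lam (i + 1 + k)) ^ (t i) * wt lam t η (i + 1 + k) := by
          gcongr
      _ ≤ 1 * (lam (i + 1 + k + 1) / lam (i + 1 + k)) ^ (t i) *
          (η * (lam (i + 1 + k) / lam i) ^ (t i) * wt lam t η i) := by gcongr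
      _ = _ := by
          rw [show i + 1 + (k + 1) = i + 1 + k + 1 from rfl]
          simp only [div_pow]
          field_simp

lemma wt_down (lam : ℕ → ℝ) (t : ℕ → ℕ) (η : ℝ) (hl : ∀ i, 0 < lam i) (hη : 0 < η)
    (hanti : Antitone lam) (ht : Monotone t) (b k T : ℕ) (hT : k ≠ 0 → t (b + k - 1) ≤ T) :
    wt lam t η b * η ^ k ≤ (lam b / lam (b + k)) ^ T * wt lam t η (b + k) := by
  induction k with
  | zero => have := (hl b).ne'; simp [div_self this]
  | succ k ih =>
    have hw := wt_pos lam t η hl hη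
    have hT' : t (b + k) ≤ T := hT (by omega)
    have ih' := ih (fun _ => (ht (by omega)).trans hT')
    have p0 := hl b
    have p1 := hl (b + k)
    have p2 := hl (b + k + 1)
    have h1 : wt lam t η (b + (k + 1)) =
      η * (lam (b + k + 1) / lam (b + k)) ^ (t (b + k)) * wt lam t η (b + k) := rfl
    have hr : lam (b + k + 1) / lam (b + k) ≤ 1 := by
      rw [div_le_one p1]; exact hanti (by omega)
    have h2 : (lam (b + k + 1) / lam (b + k)) ^ T ≤
        (lam (b + k + 1) / lam (b + k)) ^ (t (b + k)) :=
      pow_le_pow_of_le_one (by positivity) hr hT'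
    have := hw (b + k)
    rw [h1, show b + (k + 1) = b + k + 1 from rfl]
    calc wt lam t η b * η ^ (k + 1) = η * (wt lam t η b * η ^ k) := by ring
      _ ≤ η * ((lam b / lam (b + k)) ^ T * wt lam t η (b + k)) := by gcongr
      _ = (lam b / lam (b + k + 1)) ^ T *
        (η * (lam (b + k + 1) / lam (b + k)) ^ T * wt lam t η (b + k)) := by
          simp only [div_pow]; field_simp
      _ ≤ _ := by gcongr

lemma aux_dual {n m : ℕ} (d : Fin (n + 1) → ℂ) (C : Matrix (Fin m) (Fin (n + 1)) ℂ)
    (hnd : NonDeg d C) (j : Fin (n + 1)) :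
    ∃ b : Fin m → ℂ, ∀ i, ‖d i‖ = ‖d j‖ → ∑ l, b l * C l i = if i = j then 1 else 0 := by
  classical
  have h := hnd ‖d j‖
  obtain ⟨g, hg⟩ := LinearMap.exists_leftInverse_of_injective _
    (LinearMap.ker_eq_bot.2 (linearIndependent_iff_injective_fintypeLinearCombination.1 h))
  refine ⟨fun l => g (Pi.single l 1) ⟨j, rfl⟩, fun i hi => ?_⟩
  have h1 := LinearMap.congr_fun hg (Pi.single (⟨i, hi⟩ : {i // ‖d i‖ = ‖d j‖}) 1)
  simp only [LinearMap.comp_apply, LinearMap.id_apply, Fintype.linearCombination_apply_single,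
    one_smul] at h1
  have h2 : (fun l => C l i) = ∑ l, C l i • (Pi.single l (1 : ℂ) : Fin m → ℂ) := by
    ext l'; simp [Finset.sum_apply, Pi.single_apply]
  rw [h2, map_sum] at h1
  have h3 := congrFun h1 ⟨j, rfl⟩
  simp only [map_smul, Finset.sum_apply, Pi.smul_apply, smul_eq_mul, Pi.single_apply] at h3
  rw [show (∑ l, g (Pi.single l 1) ⟨j, rfl⟩ * C l i) = ∑ l, C l i * g (Pi.single l 1) ⟨j, rfl⟩ from
    Finset.sum_congr rfl (fun _ _ => mul_comm _ _), h3]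
  simp only [Subtype.mk.injEq, eq_comm]

/-- the vector `D ^ t x` -/
noncomputable def dp {n : ℕ} (d : Fin (n + 1) → ℂ) (t : ℕ) (x : Fin (n + 1) → ℂ) :
    Fin (n + 1) → ℂ := fun j => ((d j)⁻¹) ^ t * x j

lemma aux_comp {n m : ℕ} (d : Fin (n + 1) → ℂ) (C : Matrix (Fin m) (Fin (n + 1)) ℂ)
    (hd0 : ∀ i, d i ≠ 0) (hnd : NonDeg d C) :
    ∃ K : ℝ, 1 ≤ K ∧ ∀ (t : ℕ) (x : Fin (n + 1) → ℂ) (Y : ℝ), 0 ≤ Y →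
      (∀ l, ‖(C *ᵥ dp d t x) l‖ ≤ Y) → ∀ j,
      ‖x j‖ ≤ K * (‖d j‖ ^ t * Y + ∑ i, if ‖d i‖ = ‖d j‖ then 0 else
        (‖d j‖ / ‖d i‖) ^ t * ‖x i‖) := by
  choose b hb using aux_dual d C hnd
  set K1 : ℝ := ∑ j, ∑ l, ‖b j l‖ with hK1
  set K2 : ℝ := ∑ j, ∑ i, ‖∑ l, b j l * C l i‖ with hK2
  have hK1' : 0 ≤ K1 := by positivity
  have hK2' : 0 ≤ K2 := by positivity
  refine ⟨1 + K1 + K2, by linarith, fun t x Y hY0 hY j => ?_⟩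
  set f : Fin (n + 1) → ℂ := fun i => ∑ l, b j l * C l i with hf
  have e1 : ∑ l, b j l * (C *ᵥ dp d t x) l = ∑ i, f i * dp d t x i := by
    simp only [Matrix.mulVec, dotProduct, hf, Finset.mul_sum, Finset.sum_mul]
    rw [Finset.sum_comm]
    simp only [mul_assoc]
  have e2 : ∑ i, f i * dp d t x i = dp d t x j +
      ∑ i, if ‖d i‖ = ‖d j‖ then 0 else f i * dp d t x i := by
    have e3 : dp d t x j = ∑ i, if i = j then dp d t x i else 0 := by simp
    rw [e3, ← Finset.sum_add_distrib]
    refine Finset.sum_congr rfl fun i _ => ?_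
    by_cases h : ‖d i‖ = ‖d j‖
    · have := hb j i h
      simp only [hf, this, h, if_true]
      split_ifs <;> simp
    · have : i ≠ j := fun h' => h (by rw [h'])
      simp [h, this]
  have hj : x j = d j ^ t * (∑ l, b j l * (C *ᵥ dp d t x) l -
      ∑ i, if ‖d i‖ = ‖d j‖ then 0 else f i * dp d t x i) := by
    rw [e1, e2, add_sub_cancel_right]
    simp only [dp]
    rw [← mul_assoc, ← mul_pow, mul_inv_cancel₀ (hd0 j), one_pow, one_mul]
  have hb1 : ∑ l, ‖b j l‖ ≤ K1 :=
    Finset.single_le_sum (f := fun j => ∑ l, ‖b j l‖) (fun _ _ => by positivity) (Finset.mem_univ j)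
  have hb2 : ∀ i, ‖f i‖ ≤ K2 := fun i =>
    (Finset.single_le_sum (f := fun i => ‖∑ l, b j l * C l i‖) (fun _ _ => by positivity)
      (Finset.mem_univ i)).trans
    (Finset.single_le_sum (f := fun j => ∑ i, ‖∑ l, b j l * C l i‖) (fun _ _ => by positivity)
      (Finset.mem_univ j))
  have n1 : ‖∑ l, b j l * (C *ᵥ dp d t x) l‖ ≤ ∑ l, ‖b j l‖ * Y :=
    (norm_sum_le _ _).trans (Finset.sum_le_sum fun l _ => by
      rw [norm_mul]; exact mul_le_mul_of_nonneg_left (hY l) (norm_nonneg _))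
  have n1' : (∑ l, ‖b j l‖ * Y) ≤ (1 + K1 + K2) * Y := by
    rw [← Finset.sum_mul]
    exact mul_le_mul_of_nonneg_right (by linarith) hY0
  have n2 : ‖∑ i, if ‖d i‖ = ‖d j‖ then 0 else f i * dp d t x i‖ ≤
      ∑ i, if ‖d i‖ = ‖d j‖ then 0 else (1 + K1 + K2) * ((‖d i‖⁻¹) ^ t * ‖x i‖) := by
    refine (norm_sum_le _ _).trans (Finset.sum_le_sum fun i _ => ?_)
    split_ifs
    · simp
    · rw [norm_mul]
      simp only [dp, norm_mul, norm_pow, norm_inv]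
      exact mul_le_mul_of_nonneg_right (by linarith [hb2 i]) (by positivity)
  rw [hj, norm_mul, norm_pow]
  calc ‖d j‖ ^ t * _ ≤ ‖d j‖ ^ t * ((1 + K1 + K2) * Y +
        ∑ i, if ‖d i‖ = ‖d j‖ then 0 else (1 + K1 + K2) * ((‖d i‖⁻¹) ^ t * ‖x i‖)) := by
        gcongr
        exact (norm_sub_le _ _).trans (add_le_add (n1.trans n1') n2)
    _ = _ := by
        rw [mul_add, mul_add, Finset.mul_sum, Finset.mul_sum]
        congr 1
        · ring
        · refine Finset.sum_congr rfl fun i _ => ?_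
          split_ifs
          · simp
          · rw [div_eq_mul_inv, mul_pow]; ring

lemma aux_obs {n m : ℕ} (d : Fin (n + 1) → ℂ) (C : Matrix (Fin m) (Fin (n + 1)) ℂ)
    (hsort : ∀ i j : Fin (n + 1), i ≤ j → ‖d j‖ ≤ ‖d i‖)
    (hunst : ∀ i, 1 < ‖d i‖) (hnd : NonDeg d C) :
    ∃ L : ℕ, ∃ c : ℝ, 0 < c ∧ ∀ (t : ℕ → ℕ), (∀ i, t i + L ≤ t (i + 1)) →
      ∀ (x : Fin (n + 1) → ℂ) (Y : ℝ), 0 ≤ Y →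
      (∀ i : Fin (n + 1), ∀ l, ‖d 0‖ ^ (t i) * ‖(C *ᵥ dp d (t i) x) l‖ ≤ Y) →
      ∀ j, ‖x j‖ ≤ c * Y := by
  have hd0 : ∀ i, d i ≠ 0 := fun i h => by have := hunst i; simp [h] at this; linarith
  have hdp : ∀ i, 0 < ‖d i‖ := fun i => by linarith [hunst i]
  obtain ⟨K, hK1, hK⟩ := aux_comp d C hd0 hnd
  set η : ℝ := (2 * K * (n + 1))⁻¹ with hη
  have hη0 : 0 < η := by positivity
  have hη1 : η ≤ 1 := by
    apply inv_le_one_of_one_le₀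
    have : (0 : ℝ) ≤ n := by positivity
    nlinarith
  have hL : ∀ᶠ L : ℕ in Filter.atTop, ∀ i j : Fin (n + 1), ‖d i‖ < ‖d j‖ →
      (‖d i‖ / ‖d j‖) ^ L ≤ η ^ (n + 1) := by
    rw [Filter.eventually_all]; intro i
    rw [Filter.eventually_all]; intro j
    by_cases h : ‖d i‖ < ‖d j‖
    · have := tendsto_pow_atTop_nhds_zero_of_lt_one (r := ‖d i‖ / ‖d j‖)
        (by positivity) ((div_lt_one (hdp j)).2 h)
      filter_upwards [this.eventually_le_const (show 0 < η ^ (n + 1) by positivity)] with L hL _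
      exact hL
    · simp [h]
  obtain ⟨L, hL⟩ := hL.exists
  refine ⟨L, 2 * K * (η ^ n)⁻¹, by positivity, fun t ht x Y hY0 hY => ?_⟩
  have htm : Monotone t := monotone_nat_of_le_succ fun i => by have := ht i; omega
  set lam : ℕ → ℝ := fun i => ‖d ⟨min i n, by omega⟩‖ with hlam
  have hlamd : ∀ i : Fin (n + 1), lam i = ‖d i‖ := by
    intro i; simp only [hlam]; congr 2; ext; simp; omega
  have hl : ∀ i, 0 < lam i := fun i => hdp _
  have hanti : Antitone lam := fun i j hij => hsort _ _ (by
    rw [Fin.le_def]; simp only; omega)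
  set w : Fin (n + 1) → ℝ := fun i => wt lam t η i with hw
  have hw0 : ∀ i, 0 < w i := fun i => wt_pos lam t η hl hη0 i
  have hw1 : ∀ i, w i ≤ 1 := by
    intro i
    rcases i with ⟨i, hi⟩
    cases i with
    | zero => simp [hw, wt]
    | succ i =>
      have := wt_up lam t η hl hη0 hη1 hanti htm 0 i
      simp only [hw]
      rw [show i + 1 = 0 + 1 + i by omega]
      refine this.trans ?_
      have h0 := hl 0
      have h1 := hl (0 + 1 + i)
      have : lam (0 + 1 + i) / lam 0 ≤ 1 := (div_le_one h0).2 (hanti (by omega))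
      simp only [wt, mul_one]
      exact mul_le_one₀ hη1 (by positivity) (pow_le_one₀ (by positivity) this)
  have hpair : ∀ i j : Fin (n + 1), ‖d i‖ ≠ ‖d j‖ →
      (‖d j‖ / ‖d i‖) ^ (t j) * w i ≤ η * w j := by
    intro i j hne
    have pi := hdp i
    have pj := hdp j
    have wi := hw0 i
    have wj := hw0 j
    rcases lt_trichotomy i j with hij | hij | hij
    · have hlt : ‖d j‖ < ‖d i‖ := lt_of_le_of_ne (hsort i j hij.le) (Ne.symm hne)
      obtain ⟨k, hk⟩ : ∃ k, (j : ℕ) = i + (k + 1) := ⟨j - i - 1, by rw [Fin.lt_def] at hij; omega⟩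
      have h1 := wt_down lam t η hl hη0 hanti htm i (k + 1) (t (i + k)) (fun _ => le_rfl)
      rw [← hk, hlamd, hlamd] at h1
      change w i * η ^ (k + 1) ≤ (‖d i‖ / ‖d j‖) ^ (t (i + k)) * w j at h1
      have h2 : t (i + k) + L ≤ t j := by rw [hk]; exact ht _
      have h3 := hL j i hlt
      have hk2 : k + 1 ≤ n := by have := j.2; omega
      have h4 : η ^ n ≤ η ^ (k + 1) := pow_le_pow_of_le_one hη0.le hη1 hk2
      have h5 : (‖d j‖ / ‖d i‖) ^ (t j) ≤ (‖d j‖ / ‖d i‖) ^ (t (i + k)) * η ^ (n + 1) := by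
        calc _ ≤ (‖d j‖ / ‖d i‖) ^ (t (i + k) + L) :=
              pow_le_pow_of_le_one (by positivity) ((div_le_one pi).2 hlt.le) h2
          _ = (‖d j‖ / ‖d i‖) ^ (t (i + k)) * (‖d j‖ / ‖d i‖) ^ L := pow_add _ _ _
          _ ≤ _ := by gcongr
      have h6 : (‖d j‖ / ‖d i‖) ^ (t (i + k)) * (‖d i‖ / ‖d j‖) ^ (t (i + k)) = 1 := by
        rw [← mul_pow]
        have : ‖d j‖ / ‖d i‖ * (‖d i‖ / ‖d j‖) = 1 := by field_simp
        rw [this, one_pow]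
      have h7 : (‖d j‖ / ‖d i‖) ^ (t j) * w i * η ^ n ≤ η * w j * η ^ n := by
        calc _ ≤ ((‖d j‖ / ‖d i‖) ^ (t (i + k)) * η ^ (n + 1)) * (w i * η ^ (k + 1)) := by
              rw [mul_assoc]
              gcongr
          _ ≤ ((‖d j‖ / ‖d i‖) ^ (t (i + k)) * η ^ (n + 1)) *
              ((‖d i‖ / ‖d j‖) ^ (t (i + k)) * w j) := by gcongr
          _ = ((‖d j‖ / ‖d i‖) ^ (t (i + k)) * (‖d i‖ / ‖d j‖) ^ (t (i + k))) *
              (η * w j * η ^ n) := by ring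
          _ = _ := by rw [h6, one_mul]
      exact le_of_mul_le_mul_right h7 (by positivity)
    · exact absurd (by rw [hij]) hne
    · obtain ⟨k, hk⟩ : ∃ k, (i : ℕ) = j + 1 + k := ⟨i - j - 1, by rw [Fin.lt_def] at hij; omega⟩
      have h1 := wt_up lam t η hl hη0 hη1 hanti htm j k
      rw [← hk, hlamd, hlamd] at h1
      change w i ≤ η * (‖d i‖ / ‖d j‖) ^ (t j) * w j at h1
      calc _ ≤ (‖d j‖ / ‖d i‖) ^ (t j) * (η * (‖d i‖ / ‖d j‖) ^ (t j) * w j) := by gcongr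
        _ = ((‖d j‖ / ‖d i‖) * (‖d i‖ / ‖d j‖)) ^ (t j) * (η * w j) := by rw [mul_pow]; ring
        _ = _ := by
          have : ‖d j‖ / ‖d i‖ * (‖d i‖ / ‖d j‖) = 1 := by field_simp
          rw [this, one_pow, one_mul]
  obtain ⟨j, hj⟩ := Finite.exists_max (fun j => ‖x j‖ / w j)
  set M := ‖x j‖ / w j with hM
  have hM0 : 0 ≤ M := div_nonneg (norm_nonneg _) (hw0 j).le
  have hxM : ∀ i, ‖x i‖ ≤ w i * M := fun i => by
    have := hj i
    rw [div_le_iff₀ (hw0 i)] at this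
    linarith
  have hxj : ‖x j‖ = w j * M := by rw [hM]; field_simp [(hw0 j).ne']
  have pa := hdp 0
  have pj := hdp j
  have wj := hw0 j
  have h1 := hK (t j) x (Y / ‖d 0‖ ^ (t j)) (by positivity) (fun l => by
    rw [le_div_iff₀ (by positivity), mul_comm]; exact hY j l) j
  have h2 : (∑ i, if ‖d i‖ = ‖d j‖ then 0 else (‖d j‖ / ‖d i‖) ^ (t j) * ‖x i‖) ≤
      (n + 1) * (η * w j * M) := by
    calc _ ≤ ∑ i : Fin (n + 1), η * w j * M := by
          refine Finset.sum_le_sum fun i _ => ?_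
          split_ifs with h
          · positivity
          · have := hdp i
            calc _ ≤ (‖d j‖ / ‖d i‖) ^ (t j) * (w i * M) := by gcongr; exact hxM i
              _ = ((‖d j‖ / ‖d i‖) ^ (t j) * w i) * M := by ring
              _ ≤ _ := mul_le_mul_of_nonneg_right (hpair i j h) hM0
      _ = _ := by simp
  have h3 : K * ((n + 1) * (η * w j * M)) = w j * M / 2 := by
    rw [hη]; field_simp
  have h4 : w j * M ≤ 2 * K * (‖d j‖ ^ (t j) * (Y / ‖d 0‖ ^ (t j))) := by
    rw [hxj] at h1
    have : K * (‖d j‖ ^ t j * (Y / ‖d 0‖ ^ t j) +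
        ∑ i, if ‖d i‖ = ‖d j‖ then 0 else (‖d j‖ / ‖d i‖) ^ (t j) * ‖x i‖) ≤
        K * (‖d j‖ ^ t j * (Y / ‖d 0‖ ^ t j) + (n + 1) * (η * w j * M)) := by gcongr
    nlinarith
  have h5 : η ^ n * (‖d j‖ / ‖d 0‖) ^ (t j) ≤ w j := by
    have h := wt_down lam t η hl hη0 hanti htm 0 j (t j) (fun _ => htm (by omega))
    rw [zero_add, hlamd j, show lam 0 = ‖d 0‖ from hlamd 0] at h
    simp only [wt, one_mul] at h
    change η ^ (j : ℕ) ≤ (‖d 0‖ / ‖d j‖) ^ t j * w j at h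
    have h' : η ^ n ≤ η ^ (j : ℕ) := pow_le_pow_of_le_one hη0.le hη1 (by omega)
    calc _ ≤ ((‖d 0‖ / ‖d j‖) ^ t j * w j) * (‖d j‖ / ‖d 0‖) ^ (t j) := by
          gcongr; exact h'.trans h
      _ = ((‖d 0‖ / ‖d j‖) * (‖d j‖ / ‖d 0‖)) ^ (t j) * w j := by rw [mul_pow]; ring
      _ = _ := by
        have : ‖d 0‖ / ‖d j‖ * (‖d j‖ / ‖d 0‖) = 1 := by field_simp
        rw [this, one_pow, one_mul]
  have h6 : M ≤ 2 * K * (η ^ n)⁻¹ * Y := by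
    have h7 : (η ^ n * (‖d j‖ / ‖d 0‖) ^ (t j)) * M ≤
        2 * K * (‖d j‖ ^ (t j) * (Y / ‖d 0‖ ^ (t j))) :=
      le_trans (by gcongr) h4
    have h8 : 2 * K * (‖d j‖ ^ (t j) * (Y / ‖d 0‖ ^ (t j))) =
        (η ^ n * (‖d j‖ / ‖d 0‖) ^ (t j)) * (2 * K * (η ^ n)⁻¹ * Y) := by
      rw [div_pow]; field_simp
    rw [h8] at h7
    exact le_of_mul_le_mul_left h7 (by positivity)
  intro i
  calc ‖x i‖ ≤ w i * M := hxM i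
    _ ≤ 1 * M := by gcongr; exact hw1 i
    _ ≤ _ := by rw [one_mul]; exact h6

end obs

section path
open scoped MatrixOrder

noncomputable def nsq {ι : Type} [Fintype ι] (x : ι → ℂ) : ℝ := ∑ i, ‖x i‖ ^ 2

lemma nsq_nonneg {ι : Type} [Fintype ι] (x : ι → ℂ) : 0 ≤ nsq x := by
  unfold nsq; positivity

lemma star_dot_self {ι : Type} [Fintype ι] (x : ι → ℂ) : star x ⬝ᵥ x = (nsq x : ℂ) := by
  simp only [dotProduct, nsq, Pi.star_apply, Complex.ofReal_sum]
  refine Finset.sum_congr rfl fun i _ => ?_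
  rw [Complex.star_def, Complex.conj_mul']
  push_cast; rfl

noncomputable def Qf {n m : ℕ} (d : Fin (n + 1) → ℂ) (C : Matrix (Fin m) (Fin (n + 1)) ℂ)
    (ε β : ℝ) (γ : ℕ → ℝ) : ℕ → (Fin (n + 1) → ℂ) → ℝ
  | 0, x => ε * nsq x
  | k + 1, x => β * (Qf d C ε β γ k (dp d 1 x) + γ k * ε * nsq (C *ᵥ dp d 1 x))

lemma info_quad {n m : ℕ} (d : Fin (n + 1) → ℂ) (C : Matrix (Fin m) (Fin (n + 1)) ℂ)
    (ε β : ℝ) (γ : ℕ → ℝ) (k : ℕ) (x : Fin (n + 1) → ℂ) :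
    star x ⬝ᵥ (infoX (Matrix.diagonal fun i => (d i)⁻¹) C ε β γ k *ᵥ x) =
      (Qf d C ε β γ k x : ℂ) := by
  induction k generalizing x with
  | zero =>
    simp only [infoX, Qf, Matrix.smul_mulVec, Matrix.one_mulVec, dotProduct_smul, star_dot_self,
      smul_eq_mul, Complex.ofReal_mul]
  | succ k ih =>
    have hD : (Matrix.diagonal fun i => (d i)⁻¹) *ᵥ x = dp d 1 x := by
      ext i; simp [Matrix.mulVec_diagonal, dp]
    simp only [infoX, Qf, Matrix.smul_mulVec, dotProduct_smul, smul_eq_mul, Complex.ofReal_mul,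
      Complex.ofReal_add]
    rw [← ih, ← Matrix.mulVec_mulVec, ← Matrix.mulVec_mulVec, hD, Matrix.dotProduct_mulVec,
      ← Matrix.star_mulVec, hD, Matrix.add_mulVec, dotProduct_add, Matrix.smul_mulVec,
      dotProduct_smul, ← Matrix.mulVec_mulVec, Matrix.dotProduct_mulVec _ Cᴴ, ← Matrix.star_mulVec,
      star_dot_self, smul_eq_mul]

lemma info_herm {ι κ : Type} [Fintype ι] [Fintype κ] [DecidableEq ι]
    (D : Matrix ι ι ℂ) (C : Matrix κ ι ℂ) (ε β : ℝ) (γ : ℕ → ℝ) (k : ℕ) :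
    (infoX D C ε β γ k).IsHermitian := by
  induction k with
  | zero => simp [infoX, Matrix.IsHermitian, Matrix.conjTranspose_smul]
  | succ k ih =>
    have ih' : (infoX D C ε β γ k)ᴴ = infoX D C ε β γ k := ih
    simp only [infoX, Matrix.IsHermitian, Matrix.conjTranspose_smul, Matrix.conjTranspose_mul,
      Matrix.conjTranspose_add, Matrix.conjTranspose_conjTranspose, ih', Complex.star_def,
      Complex.conj_ofReal, Matrix.mul_assoc]

lemma dp_one {n : ℕ} (d : Fin (n + 1) → ℂ) (t : ℕ) (x : Fin (n + 1) → ℂ) :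
    dp d t (dp d 1 x) = dp d (t + 1) x := by
  ext i; simp only [dp]; ring

lemma dp_one' {n : ℕ} (d : Fin (n + 1) → ℂ) (t : ℕ) (x : Fin (n + 1) → ℂ) :
    dp d 1 (dp d t x) = dp d (t + 1) x := by
  ext i; simp only [dp]; ring

lemma Qf_nonneg {n m : ℕ} (d : Fin (n + 1) → ℂ) (C : Matrix (Fin m) (Fin (n + 1)) ℂ)
    (ε β : ℝ) (hε : 0 < ε) (hβ : 0 < β) (γ : ℕ → ℝ) (hγ : ∀ i, γ i = 0 ∨ γ i = 1) (k : ℕ)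
    (x : Fin (n + 1) → ℂ) : 0 ≤ Qf d C ε β γ k x := by
  induction k generalizing x with
  | zero => exact mul_nonneg hε.le (nsq_nonneg _)
  | succ k ih =>
    have h1 := ih (dp d 1 x)
    have h2 := nsq_nonneg (C *ᵥ dp d 1 x)
    have h3 : 0 ≤ γ k := by rcases hγ k with h | h <;> simp [h]
    simp only [Qf]; positivity

lemma Qf_ge {n m : ℕ} (d : Fin (n + 1) → ℂ) (C : Matrix (Fin m) (Fin (n + 1)) ℂ)
    (ε β : ℝ) (hε : 0 < ε) (hβ : 0 < β) (γ : ℕ → ℝ) (hγ : ∀ i, γ i = 0 ∨ γ i = 1) (t j : ℕ)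
    (x : Fin (n + 1) → ℂ) : β ^ t * Qf d C ε β γ j (dp d t x) ≤ Qf d C ε β γ (j + t) x := by
  induction t generalizing x with
  | zero =>
    have : dp d 0 x = x := by ext i; simp [dp]
    simp [this]
  | succ t ih =>
    have h1 := ih (dp d 1 x)
    rw [dp_one] at h1
    have h2 := nsq_nonneg (C *ᵥ dp d 1 x)
    have h3 : 0 ≤ γ (j + t) := by rcases hγ (j + t) with h | h <;> simp [h]
    have h4 : Qf d C ε β γ (j + (t + 1)) x = β * (Qf d C ε β γ (j + t) (dp d 1 x) +
      γ (j + t) * ε * nsq (C *ᵥ dp d 1 x)) := rfl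
    rw [h4]
    calc _ = β * (β ^ t * Qf d C ε β γ j (dp d (t + 1) x) + 0) := by ring
      _ ≤ _ := by gcongr; positivity

lemma Qf_ge_zero {n m : ℕ} (d : Fin (n + 1) → ℂ) (C : Matrix (Fin m) (Fin (n + 1)) ℂ)
    (hsort : ∀ i j : Fin (n + 1), i ≤ j → ‖d j‖ ≤ ‖d i‖)
    (hunst : ∀ i, 1 < ‖d i‖)
    (ε β : ℝ) (hε : 0 < ε) (hβ : 0 < β) (γ : ℕ → ℝ) (hγ : ∀ i, γ i = 0 ∨ γ i = 1) (k : ℕ)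
    (x : Fin (n + 1) → ℂ) :
    ε * (β / ‖d 0‖ ^ 2) ^ k * nsq x ≤ Qf d C ε β γ k x := by
  have h := Qf_ge d C ε β hε hβ γ hγ k 0 x
  rw [zero_add] at h
  refine le_trans ?_ h
  simp only [Qf]
  have : (‖d 0‖ ^ 2)⁻¹ ^ k * nsq x ≤ nsq (dp d k x) := by
    simp only [nsq, Finset.mul_sum]
    refine Finset.sum_le_sum fun i _ => ?_
    simp only [dp, norm_mul, norm_pow, norm_inv, mul_pow]
    refine mul_le_mul_of_nonneg_right ?_ (by positivity)
    have hi := hunst i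
    have h0 := hunst 0
    have hi' : 0 < ‖d i‖ := by linarith
    rw [← pow_mul ‖d i‖⁻¹, mul_comm k 2, pow_mul, inv_pow ‖d i‖]
    have h1 := hsort 0 i (Fin.zero_le i)
    exact pow_le_pow_left₀ (by positivity)
      (inv_anti₀ (by positivity) (pow_le_pow_left₀ hi'.le h1 2)) k
  calc _ = ε * β ^ k * ((‖d 0‖ ^ 2)⁻¹ ^ k * nsq x) := by rw [div_eq_mul_inv, mul_pow]; ring
    _ ≤ ε * β ^ k * nsq (dp d k x) := by gcongr
    _ = _ := by ring

lemma Qf_ge_meas {n m : ℕ} (d : Fin (n + 1) → ℂ) (C : Matrix (Fin m) (Fin (n + 1)) ℂ)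
    (ε β : ℝ) (hε : 0 < ε) (hβ : 0 < β) (γ : ℕ → ℝ) (hγ : ∀ i, γ i = 0 ∨ γ i = 1) (k t : ℕ)
    (ht : t < k) (h1 : γ (k - 1 - t) = 1)
    (x : Fin (n + 1) → ℂ) (l : Fin m) :
    β ^ (t + 1) * ε * ‖(C *ᵥ dp d (t + 1) x) l‖ ^ 2 ≤ Qf d C ε β γ k x := by
  have h := Qf_ge d C ε β hε hβ γ hγ t (k - 1 - t + 1) x
  rw [show k - 1 - t + 1 + t = k by omega] at h
  refine le_trans ?_ h
  simp only [Qf, h1, dp_one', one_mul]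
  have h2 := Qf_nonneg d C ε β hε hβ γ hγ (k - 1 - t) (dp d (t + 1) x)
  have h3 : ‖(C *ᵥ dp d (t + 1) x) l‖ ^ 2 ≤ nsq (C *ᵥ dp d (t + 1) x) :=
    Finset.single_le_sum (f := fun l => ‖(C *ᵥ dp d (t + 1) x) l‖ ^ 2)
      (fun _ _ => by positivity) (Finset.mem_univ l)
  calc _ = β ^ t * (β * (0 + ε * ‖(C *ᵥ dp d (t + 1) x) l‖ ^ 2)) := by ring
    _ ≤ _ := by gcongr

open Classical in
lemma aux_times (L n k : ℕ) (q : ℕ → Prop) :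
    (∃ t : ℕ → ℕ, (∀ i, t i + L ≤ t (i + 1)) ∧ (∀ i ≤ n, t i < k ∧ q (t i)) ∧
      Nat.count q (t n + 1) ≤ n * L + 1) ∨ Nat.count q k ≤ n * L + 1 := by
  set p : ℕ → Prop := fun i => q i ∨ k ≤ i with hp
  have hinf : (Set.ofPred p).Infinite :=
    (Set.Ici_infinite k).mono fun i hi => Or.inr hi
  have hqp : ∀ j, Nat.count q j ≤ Nat.count p j := fun j =>
    Nat.count_mono_left fun i _ h => Or.inl h
  have hsm := Nat.nth_strictMono hinf
  by_cases h : Nat.nth p (n * L) < k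
  · left
    refine ⟨fun i => Nat.nth p (i * L), fun i => ?_, fun i hi => ?_, ?_⟩
    · have : ∀ a b, Nat.nth p a + b ≤ Nat.nth p (a + b) := fun a b => by
        induction b with
        | zero => simp
        | succ b ih => have := hsm (show a + b < a + (b + 1) by omega); omega
      simp only
      rw [add_mul, one_mul]; exact this _ _
    · have h1 : Nat.nth p (i * L) ≤ Nat.nth p (n * L) := hsm.monotone (Nat.mul_le_mul_right L hi)
      refine ⟨lt_of_le_of_lt h1 h, ?_⟩
      rcases Nat.nth_mem_of_infinite hinf (i * L) with h2 | h2
      · exact h2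
      · exact absurd (lt_of_le_of_lt h1 h) (not_lt.2 h2)
    · refine (hqp _).trans ?_
      rw [Nat.count_succ, Nat.count_nth_of_infinite hinf]
      split_ifs <;> omega
  · right
    push Not at h
    refine (hqp _).trans ((Nat.count_monotone p h).trans ?_)
    rw [Nat.count_nth_of_infinite hinf]; omega

open Classical in
lemma aux_Qf_low {n m : ℕ} (d : Fin (n + 1) → ℂ) (C : Matrix (Fin m) (Fin (n + 1)) ℂ)
    (hsort : ∀ i j : Fin (n + 1), i ≤ j → ‖d j‖ ≤ ‖d i‖)
    (hunst : ∀ i, 1 < ‖d i‖) (hnd : NonDeg d C) 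
    (ε β : ℝ) (hε : 0 < ε) (hβ : 0 < β) (hβ1 : β ≤ 1) :
    ∃ κ : ℝ, 0 < κ ∧ ∃ M : ℕ, ∀ γ : ℕ → ℝ, (∀ i, γ i = 0 ∨ γ i = 1) → ∀ k,
      ∃ T ≤ k, Nat.count (fun i => γ (k - 1 - i) = 1) T ≤ M ∧
        ∀ x, κ * (β / ‖d 0‖ ^ 2) ^ T * nsq x ≤ Qf d C ε β γ k x := by
  obtain ⟨L, c, hc, H⟩ := aux_obs d C hsort hunst hnd
  have pa : 0 < ‖d 0‖ := by linarith [hunst 0]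
  refine ⟨min ε (ε / ((n + 1) * c ^ 2)), by positivity, n * L + 1, fun γ hγ k => ?_⟩
  rcases aux_times L n k (fun i => γ (k - 1 - i) = 1) with ⟨t, ht1, ht2, ht3⟩ | h
  · refine ⟨t n + 1, (ht2 n le_rfl).1, ht3, fun x => ?_⟩
    have htm : Monotone t := monotone_nat_of_le_succ fun i => by have := ht1 i; omega
    set F := Qf d C ε β γ k x with hF
    have hF0 : 0 ≤ F := Qf_nonneg d C ε β hε hβ γ hγ k x
    set G := ‖d 0‖ ^ 2 / β with hG
    have hG1 : 1 ≤ G := by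
      rw [hG, le_div_iff₀ hβ]; nlinarith [hunst 0]
    set Y := Real.sqrt (G ^ (t n + 1) * F / ε) with hY
    have hY2 : Y ^ 2 = G ^ (t n + 1) * F / ε := Real.sq_sqrt (by positivity)
    have h1 := H (fun i => t i + 1) (fun i => by have := ht1 i; omega) x Y
      (Real.sqrt_nonneg _) (fun i l => by
        have hi : (i : ℕ) ≤ n := by omega
        have h2 := Qf_ge_meas d C ε β hε hβ γ hγ k (t i) (ht2 i hi).1 (ht2 i hi).2 x l
        apply Real.le_sqrt_of_sq_le
        set N := ‖(C *ᵥ dp d (t i + 1) x) l‖ with hN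
        have h3 : G ^ (t i + 1) ≤ G ^ (t n + 1) :=
          pow_le_pow_right₀ hG1 (Nat.succ_le_succ (htm hi))
        calc (‖d 0‖ ^ (t i + 1) * N) ^ 2 = G ^ (t i + 1) * (β ^ (t i + 1) * ε * N ^ 2) / ε := by
              rw [hG, div_pow]; field_simp
              ring
          _ ≤ G ^ (t n + 1) * F / ε := by gcongr)
    have h2 : nsq x ≤ (n + 1) * c ^ 2 * (G ^ (t n + 1) * F / ε) := by
      rw [← hY2]
      calc nsq x ≤ ∑ i : Fin (n + 1), (c * Y) ^ 2 := by
            refine Finset.sum_le_sum fun i _ => ?_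
            gcongr; exact h1 i
        _ = _ := by simp; ring
    have h3 : (β / ‖d 0‖ ^ 2) = G⁻¹ := by rw [hG, inv_div]
    rw [h3]
    calc _ ≤ (ε / ((n + 1) * c ^ 2)) * G⁻¹ ^ (t n + 1) *
          ((n + 1) * c ^ 2 * (G ^ (t n + 1) * F / ε)) := by
          gcongr
          · exact nsq_nonneg _
          · exact min_le_right _ _
      _ = F := by
          have : G ≠ 0 := by positivity
          rw [inv_pow]; field_simp
  · refine ⟨k, le_rfl, h, fun x => le_trans ?_
      (Qf_ge_zero d C hsort hunst ε β hε hβ γ hγ k x)⟩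
    gcongr
    · exact nsq_nonneg _
    · exact min_le_left _ _

noncomputable def Zf (G θ : ℝ) (γ : ℕ → ℝ) : ℕ → ℝ
  | 0 => 1
  | k + 1 => 1 + G * (if γ k = 1 then θ else 1) * Zf G θ γ k

lemma Zf_pos (G θ : ℝ) (hG : 0 < G) (hθ : 0 < θ) (γ : ℕ → ℝ) (k : ℕ) : 1 ≤ Zf G θ γ k := by
  induction k with
  | zero => simp [Zf]
  | succ k ih =>
    simp only [Zf]
    have : 0 < (if γ k = 1 then θ else 1) := by split_ifs <;> linarith
    have : 0 ≤ G * (if γ k = 1 then θ else 1) * Zf G θ γ k := by positivity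
    linarith

open Classical in
lemma Zf_ge (G θ : ℝ) (hG : 0 < G) (hθ : 0 < θ) (γ : ℕ → ℝ) (k T : ℕ) (hT : T ≤ k) :
    G ^ T * θ ^ (Nat.count (fun i => γ (k - 1 - i) = 1) T) ≤ Zf G θ γ k := by
  induction k generalizing T with
  | zero => obtain rfl : T = 0 := by omega
            simp [Zf]
  | succ k ih =>
    cases T with
    | zero => simpa using Zf_pos G θ hG hθ γ (k + 1)
    | succ T =>
      have h := ih T (by omega)
      have e : Nat.count (fun i => γ (k + 1 - 1 - i) = 1) (T + 1) =
          Nat.count (fun i => γ (k - 1 - i) = 1) T + if γ k = 1 then 1 else 0 := by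
        rw [Nat.count_succ']
        congr 1
        have : ∀ i, k + 1 - 1 - (i + 1) = k - 1 - i := fun i => by omega
        simp only [this]
      rw [e]
      simp only [Zf]
      have h2 : 0 < (if γ k = 1 then θ else 1) := by split_ifs <;> linarith
      calc G ^ (T + 1) * θ ^ (Nat.count (fun i => γ (k - 1 - i) = 1) T + if γ k = 1 then 1 else 0)
          = G * (if γ k = 1 then θ else 1) *
            (G ^ T * θ ^ (Nat.count (fun i => γ (k - 1 - i) = 1) T)) := by
            split_ifs <;> ring
        _ ≤ G * (if γ k = 1 then θ else 1) * Zf G θ γ k := by gcongr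
        _ ≤ _ := by linarith

lemma aux_path {n m : ℕ} (d : Fin (n + 1) → ℂ) (C : Matrix (Fin m) (Fin (n + 1)) ℂ)
    (hsort : ∀ i j : Fin (n + 1), i ≤ j → ‖d j‖ ≤ ‖d i‖)
    (hunst : ∀ i, 1 < ‖d i‖) (hnd : NonDeg d C) 
    (Q : Matrix (Fin (n + 1)) (Fin (n + 1)) ℂ) (R : Matrix (Fin m) (Fin m) ℂ)
    (hQ : Q.PosDef) (hR : R.PosDef) (S0 : Matrix (Fin (n + 1)) (Fin (n + 1)) ℂ)
    (h0 : S0.PosSemidef) (δ θ : ℝ) (hδ : 0 < δ) (hθ : 0 < θ) (hθ1 : θ ≤ 1) :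
    ∃ B : ℝ, 0 < B ∧ ∀ γ : ℕ → ℝ, (∀ i, γ i = 0 ∨ γ i = 1) → ∀ k,
      ricc (Matrix.diagonal d) C Q R S0 γ k ≤
        ((B * Zf (‖d 0‖ ^ 2 * (1 + δ)) θ γ k : ℝ) : ℂ) • 1 := by
  classical
  have hdp : ∀ i, 0 < ‖d i‖ := fun i => by linarith [hunst i]
  have hd0 : ∀ i, d i ≠ 0 := fun i => norm_pos_iff.1 (hdp i)
  have hDA : (Matrix.diagonal fun i => (d i)⁻¹) * Matrix.diagonal d = 1 := by
    rw [Matrix.diagonal_mul_diagonal, ← Matrix.diagonal_one]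
    congr 1; ext i; exact inv_mul_cancel₀ (hd0 i)
  have hD : (Matrix.diagonal fun i => (d i)⁻¹)ᴴ * (Matrix.diagonal fun i => (d i)⁻¹) ≤ 1 := by
    rw [Matrix.le_iff, Matrix.diagonal_conjTranspose, Matrix.diagonal_mul_diagonal,
      ← Matrix.diagonal_one, Matrix.diagonal_sub, Matrix.posSemidef_diagonal_iff]
    intro i
    have : ‖(d i)⁻¹‖ ^ 2 ≤ 1 := by
      rw [norm_inv]
      exact pow_le_one₀ (by positivity) (inv_le_one_of_one_le₀ (hunst i).le)
    simp only [Pi.star_apply, Complex.star_def, Complex.conj_mul']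
    rw [sub_nonneg]
    exact_mod_cast this
  obtain ⟨ε, hε, h1⟩ := aux_info (Matrix.diagonal d) (Matrix.diagonal fun i => (d i)⁻¹) C Q R hQ hR
    S0 h0 hDA hD δ hδ
  obtain ⟨κ, hκ, M, h2⟩ := aux_Qf_low d C hsort hunst hnd ε (1 + δ)⁻¹ hε (by positivity)
    (inv_le_one_of_one_le₀ (by linarith))
  have pa := hdp 0
  refine ⟨κ⁻¹ * (θ ^ M)⁻¹, by positivity, fun γ hγ k => ?_⟩
  obtain ⟨T, hT, hM, h3⟩ := h2 γ hγ k
  set κ' := κ * ((1 + δ)⁻¹ / ‖d 0‖ ^ 2) ^ T with hκ'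
  have hκ'0 : 0 < κ' := by positivity
  have h4 : (κ' : ℂ) • (1 : Matrix (Fin (n + 1)) (Fin (n + 1)) ℂ) ≤
      infoX (Matrix.diagonal fun i => (d i)⁻¹) C ε (1 + δ)⁻¹ γ k := by
    rw [Matrix.le_iff]
    have hq : ∀ x : Fin (n + 1) → ℂ, star x ⬝ᵥ ((infoX (Matrix.diagonal fun i => (d i)⁻¹) C ε (1 + δ)⁻¹ γ k -
        (κ' : ℂ) • (1 : Matrix (Fin (n + 1)) (Fin (n + 1)) ℂ)) *ᵥ x) =
        ((Qf d C ε (1 + δ)⁻¹ γ k x - κ' * nsq x : ℝ) : ℂ) := by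
      intro x
      rw [Matrix.sub_mulVec, dotProduct_sub, info_quad, Matrix.smul_mulVec, Matrix.one_mulVec,
        dotProduct_smul, star_dot_self]
      simp
    apply Matrix.PosSemidef.of_dotProduct_mulVec_nonneg
    · have h1 : (infoX (Matrix.diagonal fun i => (d i)⁻¹) C ε (1 + δ)⁻¹ γ k).IsHermitian :=
        info_herm _ _ _ _ _ _
      have h2 : ((κ' : ℂ) • (1 : Matrix (Fin (n + 1)) (Fin (n + 1)) ℂ)).IsHermitian := by
        simp [Matrix.IsHermitian, Matrix.conjTranspose_smul]
      exact h1.sub h2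
    · intro x
      rw [hq]
      have := h3 x
      have : 0 ≤ Qf d C ε (1 + δ)⁻¹ γ k x - κ' * nsq x := by linarith
      exact_mod_cast this
  refine (aux_inv_bound _ _ κ' hκ'0 h4 (h1 γ hγ k)).trans ?_
  rw [Matrix.le_iff, ← sub_smul, ← Complex.ofReal_sub]
  have h5 := Zf_ge (‖d 0‖ ^ 2 * (1 + δ)) θ (by positivity) hθ γ k T hT
  have h6 : κ'⁻¹ ≤ κ⁻¹ * (θ ^ M)⁻¹ * Zf (‖d 0‖ ^ 2 * (1 + δ)) θ γ k := by
    have h7 : θ ^ M ≤ θ ^ Nat.count (fun i => γ (k - 1 - i) = 1) T :=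
      pow_le_pow_of_le_one hθ.le hθ1 hM
    have e : κ'⁻¹ = κ⁻¹ * (θ ^ M)⁻¹ * ((‖d 0‖ ^ 2 * (1 + δ)) ^ T * θ ^ M) := by
      rw [hκ', mul_inv, ← inv_pow, inv_div, div_inv_eq_mul]; field_simp
    rw [e]
    refine mul_le_mul_of_nonneg_left (le_trans ?_ h5) (by positivity)
    gcongr
  have h8 : (0 : ℂ) ≤ ((κ⁻¹ * (θ ^ M)⁻¹ * Zf (‖d 0‖ ^ 2 * (1 + δ)) θ γ k - κ'⁻¹ : ℝ) : ℂ) := by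
    have := sub_nonneg.2 h6
    exact_mod_cast this
  exact Matrix.PosSemidef.one.smul h8

end path

section prob

def Dep {E : Type} (k : ℕ) (Φ : (ℕ → ℝ) → E) : Prop :=
  ∀ γ γ' : ℕ → ℝ, (∀ i < k, γ i = γ' i) → Φ γ = Φ γ'

lemma dep_factor {E : Type} (k : ℕ) (Φ : (ℕ → ℝ) → E) (h : Dep k Φ) :
    ∃ F : (Finset.range k → Bool) → E, ∀ γ : ℕ → ℝ, (∀ i, γ i = 0 ∨ γ i = 1) →
      Φ γ = F (fun i => decide (γ i = 1)) := by
  refine ⟨fun u => Φ (fun i => if hi : i ∈ Finset.range k then (if u ⟨i, hi⟩ then 1 else 0) else 0),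
    fun γ hγ => h _ _ fun i hi => ?_⟩
  rcases hγ i with h0 | h0 <;> simp [hi, h0]

lemma dep_meas {E Ω : Type} [MeasurableSpace Ω] [MeasurableSpace E] (k : ℕ) (Φ : (ℕ → ℝ) → E)
    (h : Dep k Φ) (γ : ℕ → Ω → ℝ) (hmeas : ∀ k, Measurable (γ k))
    (h01 : ∀ k ω, γ k ω = 0 ∨ γ k ω = 1) : Measurable (fun ω => Φ (fun i => γ i ω)) := by
  obtain ⟨F, hF⟩ := dep_factor k Φ h
  have : (fun ω => Φ (fun i => γ i ω)) =
      F ∘ (fun ω (i : Finset.range k) => decide (γ i ω = 1)) := by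
    ext ω; exact hF _ fun i => h01 i ω
  rw [this]
  refine (measurable_of_finite F).comp (measurable_pi_lambda _ fun i => ?_)
  refine measurable_to_bool ?_
  have : (fun ω => decide (γ i ω = 1)) ⁻¹' {true} = γ i ⁻¹' {1} := by ext; simp
  rw [this]
  exact hmeas i (measurableSet_singleton 1)

lemma dep_int {E Ω : Type} [MeasurableSpace Ω] [MeasurableSpace E] [NormedAddCommGroup E]
    [BorelSpace E] [SecondCountableTopology E] (k : ℕ) (Φ : (ℕ → ℝ) → E)
    (h : Dep k Φ) (μ : Measure Ω) [IsProbabilityMeasure μ]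
    (γ : ℕ → Ω → ℝ) (hmeas : ∀ k, Measurable (γ k))
    (h01 : ∀ k ω, γ k ω = 0 ∨ γ k ω = 1) : Integrable (fun ω => Φ (fun i => γ i ω)) μ := by
  obtain ⟨F, hF⟩ := dep_factor k Φ h
  refine Integrable.of_bound (C := ∑ u, ‖F u‖) (dep_meas k Φ h γ hmeas h01).aestronglyMeasurable
    (Filter.Eventually.of_forall fun ω => ?_)
  rw [hF _ fun i => h01 i ω]
  exact Finset.single_le_sum (f := fun u => ‖F u‖) (fun _ _ => norm_nonneg _) (Finset.mem_univ _)

lemma dep_step {Ω : Type} [MeasurableSpace Ω] (k : ℕ) (Φ : (ℕ → ℝ) → ℝ)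
    (h : Dep k Φ) (μ : Measure Ω) [IsProbabilityMeasure μ]
    (γ : ℕ → Ω → ℝ) (hmeas : ∀ k, Measurable (γ k)) (hind : iIndepFun γ μ)
    (h01 : ∀ k ω, γ k ω = 0 ∨ γ k ω = 1) (p : ℝ)
    (hp : μ.real {ω | γ k ω = 1} = p) (a b : ℝ) :
    ∫ ω, (if γ k ω = 1 then a else b) * Φ (fun i => γ i ω) ∂μ
      = (p * a + (1 - p) * b) * ∫ ω, Φ (fun i => γ i ω) ∂μ := by
  obtain ⟨F, hF⟩ := dep_factor k Φ h
  have hS : MeasurableSet {ω | γ k ω = 1} := hmeas k (measurableSet_singleton 1)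
  have hi := hind.indepFun_finset (Finset.range k) {k} (by simp) hmeas
  have hd : Measurable (fun x : ℝ => decide (x = 1)) := by
    refine measurable_to_bool ?_
    have : (fun x : ℝ => decide (x = 1)) ⁻¹' {true} = {1} := by ext; simp
    rw [this]; exact measurableSet_singleton 1
  have hm1 : Measurable (fun v : Finset.range k → ℝ => F (fun i => decide (v i = 1))) :=
    (measurable_of_finite F).comp (measurable_pi_lambda _ fun i =>
      hd.comp (measurable_pi_apply i))
  have hm2 : Measurable (fun v : ({k} : Finset ℕ) → ℝ =>
      if v ⟨k, by simp⟩ = 1 then a else b) :=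
    Measurable.ite ((measurable_pi_apply _) (measurableSet_singleton 1)) measurable_const
      measurable_const
  have hi2 := hi.symm.comp hm2 hm1
  have key := hi2.integral_mul_eq_mul_integral
    (by
      refine (Measurable.aestronglyMeasurable ?_)
      exact hm2.comp (measurable_pi_lambda _ fun i => hmeas i))
    (by
      refine (Measurable.aestronglyMeasurable ?_)
      exact hm1.comp (measurable_pi_lambda _ fun i => hmeas i))
  have e1 : ∀ ω, Φ (fun i => γ i ω) = F (fun i : Finset.range k => decide (γ i ω = 1)) :=
    fun ω => hF _ fun i => h01 i ω
  have e2 : ∫ ω, (if γ k ω = 1 then a else b) ∂μ = p * a + (1 - p) * b := by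
    have : (fun ω => if γ k ω = 1 then a else b) =
        fun ω => b + Set.indicator {ω | γ k ω = 1} (fun _ => a - b) ω := by
      ext ω; by_cases hh : γ k ω = 1 <;> simp [hh]
    rw [this, integral_add (integrable_const _) ((integrable_const _).indicator hS),
      integral_indicator hS]
    simp [hp]; ring
  rw [← e2]
  simp_rw [e1]
  exact key

lemma matExp_psd {Ω ι : Type} [Fintype ι] [MeasurableSpace Ω] (μ : Measure Ω)
    (X : Ω → Matrix ι ι ℂ) (hi : ∀ i j, Integrable (fun ω => X ω i j) μ)
    (hX : ∀ ω, (X ω).PosSemidef) : (matExp μ X).PosSemidef := by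
  refine Matrix.PosSemidef.of_dotProduct_mulVec_nonneg ?_ fun x => ?_
  · ext i j
    simp only [matExp, Matrix.conjTranspose_apply, Matrix.of_apply, Complex.star_def]
    rw [← integral_conj]
    refine integral_congr_ae (Filter.Eventually.of_forall fun ω => ?_)
    have := (hX ω).1.apply i j
    simpa using this
  · have : star x ⬝ᵥ (matExp μ X *ᵥ x) = ∫ ω, star x ⬝ᵥ (X ω *ᵥ x) ∂μ := by
      simp only [dotProduct, Matrix.mulVec, matExp, Matrix.of_apply]
      rw [integral_finsetSum]
      · refine Finset.sum_congr rfl fun i _ => ?_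
        rw [integral_const_mul, integral_finsetSum]
        · congr 1
          refine Finset.sum_congr rfl fun j _ => ?_
          rw [integral_mul_const]
        · exact fun j _ => (hi i j).mul_const _
      · exact fun i _ => (integrable_finsetSum _ fun j _ => (hi i j).mul_const _).const_mul _
    rw [this]
    exact integral_nonneg fun ω => (hX ω).dotProduct_mulVec_nonneg x

lemma ricc_dep {ι κ : Type} [Fintype ι] [Fintype κ] [DecidableEq ι] [DecidableEq κ]
    (A : Matrix ι ι ℂ) (C : Matrix κ ι ℂ) (Q : Matrix ι ι ℂ) (R : Matrix κ κ ℂ)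
    (S0 : Matrix ι ι ℂ) (k : ℕ) : Dep k (fun γ => ricc A C Q R S0 γ k) := by
  induction k with
  | zero => intro γ γ' _; rfl
  | succ k ih =>
    intro γ γ' h
    have := ih γ γ' fun i hi => h i (by omega)
    simp only [ricc] at this ⊢
    rw [this, h k (by omega)]

end prob

section final
open scoped MatrixOrder

lemma Zf_dep (G θ : ℝ) (k : ℕ) : Dep k (fun γ => Zf G θ γ k) := by
  induction k with
  | zero => intro γ γ' _; rfl
  | succ k ih =>
    intro γ γ' h
    have := ih γ γ' fun i hi => h i (by omega)
    simp only [Zf] at this ⊢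
    rw [this, h k (by omega)]

lemma dep_comp {E F : Type} (k : ℕ) (Φ : (ℕ → ℝ) → E) (h : Dep k Φ) (f : E → F) :
    Dep k (fun γ => f (Φ γ)) := fun γ γ' hg => congrArg f (h γ γ' hg)

lemma Zf_exp {Ω : Type} [MeasurableSpace Ω] (μ : Measure Ω) [IsProbabilityMeasure μ]
    (γ : ℕ → Ω → ℝ) (hmeas : ∀ k, Measurable (γ k)) (hind : iIndepFun γ μ)
    (h01 : ∀ k ω, γ k ω = 0 ∨ γ k ω = 1) (p : ℝ)
    (hp : ∀ k, μ.real {ω | γ k ω = 1} = p) (G θ : ℝ) (h0 : 0 ≤ G * (p * θ + (1 - p)))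
    (h1 : G * (p * θ + (1 - p)) < 1) (k : ℕ) :
    ∫ ω, Zf G θ (fun i => γ i ω) k ∂μ ≤ (1 - G * (p * θ + (1 - p)))⁻¹ := by
  have hpos : 0 < 1 - G * (p * θ + (1 - p)) := by linarith
  induction k with
  | zero =>
    simp only [Zf, integral_const, probReal_univ, smul_eq_mul, mul_one]
    exact (one_le_inv₀ hpos).2 (by linarith)
  | succ k ih =>
    have hstep := dep_step k (fun γ => Zf G θ γ k) (Zf_dep G θ k) μ γ hmeas hind h01 p (hp k)
      (G * θ) G
    have hint : Integrable
        (fun ω => (if γ k ω = 1 then G * θ else G) * Zf G θ (fun i => γ i ω) k) μ := by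
      refine dep_int (k + 1) (fun γ => (if γ k = 1 then G * θ else G) * Zf G θ γ k) ?_ μ γ hmeas h01
      intro g g' h
      have := Zf_dep G θ k g g' fun i hi => h i (by omega)
      simp only at this ⊢
      rw [this, h k (by omega)]
    have e : ∫ ω, Zf G θ (fun i => γ i ω) (k + 1) ∂μ
        = 1 + G * (p * θ + (1 - p)) * ∫ ω, Zf G θ (fun i => γ i ω) k ∂μ := by
      have : (fun ω => Zf G θ (fun i => γ i ω) (k + 1)) =
          fun ω => 1 + (if γ k ω = 1 then G * θ else G) * Zf G θ (fun i => γ i ω) k := by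
        ext ω; simp only [Zf]; split_ifs <;> ring
      rw [this, integral_add (integrable_const _) hint, hstep]
      simp only [integral_const, probReal_univ, smul_eq_mul]; ring
    rw [e]
    set φ := G * (p * θ + (1 - p))
    calc _ ≤ 1 + φ * (1 - φ)⁻¹ := by gcongr
      _ = (1 - φ)⁻¹ := by field_simp; ring

lemma upper_part {n m : ℕ} (d : Fin (n + 1) → ℂ) (C : Matrix (Fin m) (Fin (n + 1)) ℂ)
    (hsort : ∀ i j : Fin (n + 1), i ≤ j → ‖d j‖ ≤ ‖d i‖)
    (hunst : ∀ i, 1 < ‖d i‖) (hnd : NonDeg d C)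
    (Q : Matrix (Fin (n + 1)) (Fin (n + 1)) ℂ) (R : Matrix (Fin m) (Fin m) ℂ)
    (hQ : Q.PosDef) (hR : R.PosDef)
    {Ω : Type} [MeasurableSpace Ω] (μ : Measure Ω) [IsProbabilityMeasure μ]
    (γ : ℕ → Ω → ℝ) (hmeas : ∀ k, Measurable (γ k)) (hind : iIndepFun γ μ)
    (h01 : ∀ k ω, γ k ω = 0 ∨ γ k ω = 1) (p : ℝ)
    (hp : ∀ k, μ.real {ω | γ k ω = 1} = p) (hpc : 1 - (‖d 0‖ ^ 2)⁻¹ < p)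
    (S0 : Matrix (Fin (n + 1)) (Fin (n + 1)) ℂ) (h0 : S0.PosSemidef) :
    EBounded μ (fun k ω => ricc (Matrix.diagonal d) C Q R S0 (fun i => γ i ω) k) := by
  have ha : 1 < ‖d 0‖ ^ 2 := one_lt_pow₀ (hunst 0) (by norm_num)
  set a := ‖d 0‖ ^ 2 with hadef
  have hp1 : p ≤ 1 := by rw [← hp 0]; exact measureReal_le_one
  have hp0 : 0 ≤ p := by rw [← hp 0]; exact measureReal_nonneg
  have hsmall : a * (1 - p) < 1 := by
    have : 1 - p < a⁻¹ := by linarith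
    calc a * (1 - p) < a * a⁻¹ := by gcongr
      _ = 1 := by field_simp
  obtain ⟨t, ht, ht1, htφ⟩ : ∃ t : ℝ, 0 < t ∧ t ≤ 1 ∧ a * (1 + t) * (p * t + (1 - p)) < 1 := by
    have hc : Filter.Tendsto (fun t : ℝ => a * (1 + t) * (p * t + (1 - p)))
        (nhdsWithin 0 (Set.Ioi 0)) (nhds (a * (1 - p))) := by
      have : Continuous (fun t : ℝ => a * (1 + t) * (p * t + (1 - p))) := by fun_prop
      have h := (this.tendsto 0).mono_left (nhdsWithin_le_nhds (s := Set.Ioi (0 : ℝ)))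
      simpa using h
    have h1 := hc.eventually (gt_mem_nhds hsmall)
    have h2 : ∀ᶠ t in nhdsWithin (0 : ℝ) (Set.Ioi 0), t ∈ Set.Ioc (0 : ℝ) 1 :=
      Ioc_mem_nhdsGT one_pos
    obtain ⟨t, h3, h4⟩ := (h1.and h2).exists
    exact ⟨t, h4.1, h4.2, h3⟩
  obtain ⟨B, hB, hBd⟩ := aux_path d C hsort hunst hnd Q R hQ hR S0 h0 t t ht ht ht1
  rw [← hadef] at hBd
  have hG : 0 < a * (1 + t) := by positivity
  have hint : ∀ k i j, Integrable
      (fun ω => ricc (Matrix.diagonal d) C Q R S0 (fun i => γ i ω) k i j) μ := fun k i j =>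
    dep_int k (fun γ => ricc (Matrix.diagonal d) C Q R S0 γ k i j)
      (dep_comp k _ (ricc_dep (Matrix.diagonal d) C Q R S0 k) (fun M => M i j)) μ γ hmeas h01
  have hZint : ∀ k, Integrable (fun ω => Zf (a * (1 + t)) t (fun i => γ i ω) k) μ := fun k =>
    dep_int k _ (Zf_dep (a * (1 + t)) t k) μ γ hmeas h01
  refine ⟨hint, ((B * (1 - a * (1 + t) * (p * t + (1 - p)))⁻¹ : ℝ) : ℂ) • 1, ?_, fun k => ?_⟩
  · simp [Matrix.IsHermitian, Matrix.conjTranspose_smul]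
  have hZ := Zf_exp μ γ hmeas hind h01 p hp (a * (1 + t)) t
    (mul_nonneg hG.le (by nlinarith)) htφ k
  set K := (1 - a * (1 + t) * (p * t + (1 - p)))⁻¹
  set z := ∫ ω, Zf (a * (1 + t)) t (fun i => γ i ω) k ∂μ with hz
  have hZci : ∀ i j : Fin (n + 1), Integrable (fun ω =>
      ((((B * Zf (a * (1 + t)) t (fun i => γ i ω) k : ℝ) : ℂ) •
        (1 : Matrix (Fin (n + 1)) (Fin (n + 1)) ℂ)) i j)) μ := by
    intro i j
    simp only [Matrix.smul_apply, smul_eq_mul]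
    exact (((hZint k).const_mul B).ofReal).mul_const _
  have h1 : (matExp μ (fun ω => ((B * Zf (a * (1 + t)) t (fun i => γ i ω) k : ℝ) : ℂ) •
      (1 : Matrix (Fin (n + 1)) (Fin (n + 1)) ℂ) -
        ricc (Matrix.diagonal d) C Q R S0 (fun i => γ i ω) k)).PosSemidef := by
    refine matExp_psd μ _ (fun i j => ?_) fun ω => ?_
    · simp only [Matrix.sub_apply]
      exact (hZci i j).sub (hint k i j)
    · exact Matrix.le_iff.1 (hBd _ (fun i => h01 i ω) k)
  have h2 : (((B * (K - z) : ℝ) : ℂ) • (1 : Matrix (Fin (n + 1)) (Fin (n + 1)) ℂ)).PosSemidef := by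
    refine Matrix.PosSemidef.smul Matrix.PosSemidef.one ?_
    rw [Complex.zero_le_real]
    exact mul_nonneg hB.le (by linarith)
  refine aux_congr (h1.add h2) ?_
  ext i j
  simp only [matExp, Matrix.sub_apply, Matrix.add_apply, Matrix.of_apply]
  rw [integral_sub (hZci i j) (hint k i j)]
  have : ∫ ω, ((((B * Zf (a * (1 + t)) t (fun i => γ i ω) k : ℝ) : ℂ) •
        (1 : Matrix (Fin (n + 1)) (Fin (n + 1)) ℂ)) i j) ∂μ =
      ((B * z : ℝ) : ℂ) * (1 : Matrix (Fin (n + 1)) (Fin (n + 1)) ℂ) i j := by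
    simp only [Matrix.smul_apply, smul_eq_mul]
    rw [integral_mul_const, integral_complex_ofReal, integral_const_mul]
  rw [this]
  simp only [Matrix.smul_apply, smul_eq_mul]
  push_cast
  ring

lemma lower_part {n m : ℕ} (d : Fin (n + 1) → ℂ) (C : Matrix (Fin m) (Fin (n + 1)) ℂ)
    (hunst : ∀ i, 1 < ‖d i‖)
    (Q : Matrix (Fin (n + 1)) (Fin (n + 1)) ℂ) (R : Matrix (Fin m) (Fin m) ℂ)
    (hQ : Q.PosDef) (hR : R.PosDef)
    {Ω : Type} [MeasurableSpace Ω] (μ : Measure Ω) [IsProbabilityMeasure μ]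
    (γ : ℕ → Ω → ℝ) (hmeas : ∀ k, Measurable (γ k)) (hind : iIndepFun γ μ)
    (h01 : ∀ k ω, γ k ω = 0 ∨ γ k ω = 1) (p : ℝ)
    (hp : ∀ k, μ.real {ω | γ k ω = 1} = p) (hpc : p < 1 - (‖d 0‖ ^ 2)⁻¹) :
    ¬ EBounded μ (fun k ω => ricc (Matrix.diagonal d) C Q R 0 (fun i => γ i ω) k) := by
  have ha : 1 < ‖d 0‖ ^ 2 := one_lt_pow₀ (hunst 0) (by norm_num)
  have hbig : 1 < (1 - p) * ‖d 0‖ ^ 2 := by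
    have : (‖d 0‖ ^ 2)⁻¹ < 1 - p := by linarith
    calc (1 : ℝ) = (‖d 0‖ ^ 2)⁻¹ * ‖d 0‖ ^ 2 := (inv_mul_cancel₀ (by linarith)).symm
      _ < _ := by gcongr
  have hq : 0 < (Q 0 0).re := by
    have := hQ.diag_pos (i := 0)
    exact (Complex.lt_def.1 this).1
  have hpsd : ∀ g : ℕ → ℝ, (∀ i, g i = 0 ∨ g i = 1) → ∀ k,
      (ricc (Matrix.diagonal d) C Q R 0 g k).PosSemidef := fun g hg k =>
    aux_ricc_psd _ C Q R hQ hR 0 Matrix.PosSemidef.zero g hg k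
  have hdiag : ∀ g : ℕ → ℝ, (∀ i, g i = 0 ∨ g i = 1) → ∀ k,
      0 ≤ (ricc (Matrix.diagonal d) C Q R 0 g k 0 0).re := fun g hg k =>
    (Complex.le_def.1 ((hpsd g hg k).diag_nonneg (i := 0))).1
  have hstep : ∀ g : ℕ → ℝ, (∀ i, g i = 0 ∨ g i = 1) → ∀ k,
      (Q 0 0).re + (if g k = 1 then 0 else ‖d 0‖ ^ 2) *
        (ricc (Matrix.diagonal d) C Q R 0 g k 0 0).re ≤
      (ricc (Matrix.diagonal d) C Q R 0 g (k + 1) 0 0).re := by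
    intro g hg k
    simp only [ricc]
    rcases hg k with h | h
    · rw [h, aux_step_zero]
      have : (Matrix.diagonal d * ricc (Matrix.diagonal d) C Q R 0 g k * (Matrix.diagonal d)ᴴ) 0 0
          = ((‖d 0‖ ^ 2 : ℝ) : ℂ) * ricc (Matrix.diagonal d) C Q R 0 g k 0 0 := by
        rw [Matrix.diagonal_conjTranspose, Matrix.mul_diagonal, Matrix.diagonal_mul]
        have := Complex.mul_conj' (d 0)
        simp only [Pi.star_apply, Complex.star_def]
        push_cast
        rw [← this]; ring
      rw [Matrix.add_apply, this, Complex.add_re, Complex.re_ofReal_mul]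
      simp only [zero_ne_one, if_false]
      linarith
    · rw [h, aux_step_one]
      have h1 := (aux_post_psd C _ R (hpsd g hg k) hR).mul_mul_conjTranspose_same (Matrix.diagonal d)
      have h2 := (Complex.le_def.1 (h1.diag_nonneg (i := 0))).1
      rw [Matrix.add_apply, Complex.add_re]
      simp only [Complex.zero_re] at h2
      simp only [if_true]
      linarith
  rintro ⟨hint, M, -, hM⟩
  have hre : ∀ k, Integrable
      (fun ω => (ricc (Matrix.diagonal d) C Q R 0 (fun i => γ i ω) k 0 0).re) μ := fun k =>
    (hint k 0 0).re
  have hlow : ∀ k : ℕ, k * (Q 0 0).re ≤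
      ∫ ω, (ricc (Matrix.diagonal d) C Q R 0 (fun i => γ i ω) k 0 0).re ∂μ := by
    intro k
    induction k with
    | zero => simp [ricc]
    | succ k ih =>
      have hdep := dep_comp k _ (ricc_dep (Matrix.diagonal d) C Q R 0 k)
        (fun M : Matrix (Fin (n + 1)) (Fin (n + 1)) ℂ => (M 0 0).re)
      have hs := dep_step k _ hdep μ γ hmeas hind h01 p (hp k) 0 (‖d 0‖ ^ 2)
      have hi2 : Integrable (fun ω => (if γ k ω = 1 then 0 else ‖d 0‖ ^ 2) *
          (ricc (Matrix.diagonal d) C Q R 0 (fun i => γ i ω) k 0 0).re) μ := by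
        refine dep_int (k + 1) (fun γ => (if γ k = 1 then 0 else ‖d 0‖ ^ 2) *
          (ricc (Matrix.diagonal d) C Q R 0 γ k 0 0).re) ?_ μ γ hmeas h01
        intro g g' h
        have := hdep g g' fun i hi => h i (by omega)
        simp only at this ⊢
        rw [this, h k (by omega)]
      have hmono := integral_mono ((integrable_const (Q 0 0).re).add hi2) (hre (k + 1))
        (fun ω => hstep (fun i => γ i ω) (fun i => h01 i ω) k)
      have e := integral_add (integrable_const (μ := μ) (Q 0 0).re) hi2
      have hmono' : (Q 0 0).re + (p * 0 + (1 - p) * ‖d 0‖ ^ 2) *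
          ∫ ω, (ricc (Matrix.diagonal d) C Q R 0 (fun i => γ i ω) k 0 0).re ∂μ ≤
          ∫ ω, (ricc (Matrix.diagonal d) C Q R 0 (fun i => γ i ω) (k + 1) 0 0).re ∂μ := by
        refine le_trans (le_of_eq ?_) hmono
        refine Eq.trans ?_ e.symm
        rw [← hs]
        simp
      have hx0 : 0 ≤ ∫ ω, (ricc (Matrix.diagonal d) C Q R 0 (fun i => γ i ω) k 0 0).re ∂μ :=
        integral_nonneg fun ω => hdiag _ (fun i => h01 i ω) k
      push_cast
      nlinarith
  obtain ⟨k, hk⟩ := exists_nat_gt ((M 0 0).re / (Q 0 0).re)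
  rw [div_lt_iff₀ hq] at hk
  have hMk : (M - matExp μ fun ω => ricc (Matrix.diagonal d) C Q R 0 (fun i => γ i ω) k).PosSemidef :=
    hM k
  have h2 := (Complex.le_def.1 (hMk.diag_nonneg (i := 0))).1
  have e : (∫ ω, ricc (Matrix.diagonal d) C Q R 0 (fun i => γ i ω) k 0 0 ∂μ).re =
      ∫ ω, (ricc (Matrix.diagonal d) C Q R 0 (fun i => γ i ω) k 0 0).re ∂μ :=
    (integral_re (hint k 0 0)).symm
  simp only [Matrix.sub_apply, matExp, Matrix.of_apply, Complex.sub_re, Complex.zero_re] at h2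
  rw [e] at h2
  linarith [hlow k]

end final

/-- for a detectable non-degenerate system whose eigenvalues are all unstable,
the critical value is `p_c = 1 − |λ₁|⁻²`. -/
theorem stmt6 {n m : ℕ} (d : Fin (n + 1) → ℂ) (C : Matrix (Fin m) (Fin (n + 1)) ℂ)
    (hsort : ∀ i j : Fin (n + 1), i ≤ j → ‖d j‖ ≤ ‖d i‖)
    (hunst : ∀ i, 1 < ‖d i‖)
    (hdet : Detectable (Matrix.diagonal d) C)
    (hnd : NonDeg d C)
    (Q : Matrix (Fin (n + 1)) (Fin (n + 1)) ℂ) (R : Matrix (Fin m) (Fin m) ℂ)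
    (hQ : Q.PosDef) (hR : R.PosDef)
    {Ω : Type} [MeasurableSpace Ω] (μ : Measure Ω) [IsProbabilityMeasure μ]
    (γ : ℕ → Ω → ℝ) (p : ℝ)
    (hmeas : ∀ k, Measurable (γ k))
    (hind : iIndepFun γ μ)
    (h01 : ∀ k ω, γ k ω = 0 ∨ γ k ω = 1)
    (hber : ∀ k, μ {ω | γ k ω = 1} = ENNReal.ofReal p) :
    (1 - (‖d 0‖ ^ 2)⁻¹ < p →
      ∀ S0 : Matrix (Fin (n + 1)) (Fin (n + 1)) ℂ, S0.PosSemidef →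
        EBounded μ (fun k ω => ricc (Matrix.diagonal d) C Q R S0 (fun i => γ i ω) k)) ∧
    (p < 1 - (‖d 0‖ ^ 2)⁻¹ →
      ∃ S0 : Matrix (Fin (n + 1)) (Fin (n + 1)) ℂ, S0.PosSemidef ∧
        ¬ EBounded μ (fun k ω => ricc (Matrix.diagonal d) C Q R S0 (fun i => γ i ω) k)) := by
  have hreal : ∀ k, μ.real {ω | γ k ω = 1} = max p 0 := fun k => by
    rw [Measure.real, hber k, ENNReal.toReal_ofReal']
  have ha : 1 < ‖d 0‖ ^ 2 := one_lt_pow₀ (hunst 0) (by norm_num)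
  have hinv : (‖d 0‖ ^ 2)⁻¹ < 1 := inv_lt_one_of_one_lt₀ ha
  constructor
  · intro hpc S0 h0
    exact upper_part d C hsort hunst hnd Q R hQ hR μ γ hmeas hind h01 (max p 0) hreal
      (lt_of_lt_of_le hpc (le_max_left _ _)) S0 h0
  · intro hpc
    exact ⟨0, Matrix.PosSemidef.zero, lower_part d C hunst Q R hQ hR μ γ hmeas hind h01 (max p 0)
      hreal (max_lt hpc (by linarith))⟩
end

section
/- Let A = diag(A₁, A₂, A₃) be a diagonal complex matrix where every diagonal entry of A₁ has modulus > 1, every diagonal entry of A₂ has modulus = 1, and every diagonal entry of A₃ has modulus < 1, and let C = [C₁ C₂ C₃] be partitioned conformably. Assume (C,A) is detectable and take Q, R, Σ₀ to be identity matrices. Let (γ_k) be i.i.d. Bernoulli with P(γ_k = 1) = p. If there exists α > 1 such that the Riccati recursion for the system (diag(α·A₁, α·A₂), [C₁ C₂]) with identity parameters has sup_k E[P_k] bounded for every positive semidefinite initial condition at arrival probability p, then the Riccati recursion for the original system (A, C) has sup_k E[P_k] bounded for every positive semidefinite initial condition at arrival probability p. (Hence f_c(A,C) ≤ lim_{α→1⁺}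 f_c(diag(αA₁, αA₂), [C₁ C₂]): stable modes do not increase the critical value.) -/
open Matrix MeasureTheory ProbabilityTheory
open scoped ComplexOrder ENNReal

lemma loew_bound {ι : Type} [Fintype ι] [DecidableEq ι] (X : Matrix ι ι ℂ) (hX : X.IsHermitian) :
    ∃ t : ℝ, 0 ≤ t ∧ ∀ s : ℝ, t ≤ s → ((s : ℂ) • (1 : Matrix ι ι ℂ) - X).PosSemidef := by
  refine ⟨∑ i, |hX.eigenvalues i|, Finset.sum_nonneg fun i _ => abs_nonneg _, fun s hs => ?_⟩
  have hU := hX.spectral_theorem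
  set U := hX.eigenvectorUnitary
  have h1 : (s : ℂ) • (1 : Matrix ι ι ℂ) - X =
      (U : Matrix ι ι ℂ) * diagonal (fun i => ((s - hX.eigenvalues i : ℝ) : ℂ)) *
        (U : Matrix ι ι ℂ)ᴴ := by
    have h2 : diagonal (fun i => ((s - hX.eigenvalues i : ℝ) : ℂ)) =
      (s : ℂ) • (1 : Matrix ι ι ℂ) - diagonal (RCLike.ofReal ∘ hX.eigenvalues) := by
      rw [smul_one_eq_diagonal, diagonal_sub]
      congr 1; ext i; simp
    have h3 : (U : Matrix ι ι ℂ) * (U : Matrix ι ι ℂ)ᴴ = 1 := by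
      rw [← star_eq_conjTranspose]; exact Unitary.coe_mul_star_self U
    rw [h2, Matrix.mul_sub, Matrix.sub_mul]
    rw [Matrix.mul_smul, Matrix.smul_mul, Matrix.mul_one, h3]
    congr 1
  rw [h1]
  apply PosSemidef.mul_mul_conjTranspose_same
  apply PosSemidef.diagonal
  intro i
  have : hX.eigenvalues i ≤ s := (le_abs_self _).trans
    ((Finset.single_le_sum (f := fun i => |hX.eigenvalues i|)
      (fun i _ => abs_nonneg _) (Finset.mem_univ i)).trans hs)
  simpa using this

lemma ricc_le_aux {ι κ : Type} [Fintype ι] [Fintype κ] [DecidableEq ι] [DecidableEq κ]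
    (A : Matrix ι ι ℂ) (C : Matrix κ ι ℂ) (X : Matrix ι ι ℂ) (hX : X.PosSemidef)
    (K : Matrix ι κ ℂ) :
    ((A + K * C) * X * (A + K * C)ᴴ + 1 + K * Kᴴ) - riccStep A C 1 1 1 X
      = (K + A * X * Cᴴ * (C * X * Cᴴ + 1)⁻¹) * (C * X * Cᴴ + 1) *
        (K + A * X * Cᴴ * (C * X * Cᴴ + 1)⁻¹)ᴴ ∧ (C * X * Cᴴ + 1).PosDef := by
  have hW : (C * X * Cᴴ + 1).PosDef :=
    PosDef.posSemidef_add (hX.mul_mul_conjTranspose_same C) PosDef.one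
  refine ⟨?_, hW⟩
  set W := C * X * Cᴴ + 1 with hWd
  have hu : IsUnit W.det := (Matrix.isUnit_iff_isUnit_det W).1 hW.isUnit
  have hWi : (W⁻¹)ᴴ = W⁻¹ := by rw [conjTranspose_nonsing_inv, hW.isHermitian.eq]
  have e1 : (K + A * X * Cᴴ * W⁻¹)ᴴ = Kᴴ + W⁻¹ * (C * X * Aᴴ) := by
    simp only [conjTranspose_add, conjTranspose_mul, conjTranspose_conjTranspose, hWi,
      hX.isHermitian.eq, Matrix.mul_assoc]
  have e2 : (K + A * X * Cᴴ * W⁻¹) * W = K * W + A * X * Cᴴ := by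
    rw [Matrix.add_mul, Matrix.mul_assoc _ W⁻¹ W, nonsing_inv_mul _ hu, Matrix.mul_one]
  have e3 : K * W * (W⁻¹ * (C * X * Aᴴ)) = K * (C * X * Aᴴ) := by
    rw [Matrix.mul_assoc K, ← Matrix.mul_assoc W, mul_nonsing_inv _ hu, Matrix.one_mul]
  have e4 : K * W * Kᴴ = K * C * X * Cᴴ * Kᴴ + K * Kᴴ := by
    rw [hWd]; simp only [Matrix.mul_add, Matrix.add_mul, Matrix.mul_one, Matrix.mul_assoc]
  rw [e1, e2, Matrix.mul_add (K * W + A * X * Cᴴ), Matrix.add_mul (K * W), Matrix.add_mul (K * W), e3, e4]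
  unfold riccStep
  rw [← hWd]
  simp only [conjTranspose_add, conjTranspose_mul, Matrix.mul_add, Matrix.add_mul,
    Matrix.mul_assoc, Complex.ofReal_one, one_smul]
  abel

lemma ricc_le {ι κ : Type} [Fintype ι] [Fintype κ] [DecidableEq ι] [DecidableEq κ]
    (A : Matrix ι ι ℂ) (C : Matrix κ ι ℂ) (X : Matrix ι ι ℂ) (hX : X.PosSemidef)
    (g : ℝ) (hg : g = 0 ∨ g = 1) (K : Matrix ι κ ℂ) (hK : g = 0 → K = 0) :
    (((A + K * C) * X * (A + K * C)ᴴ + 1 + K * Kᴴ) - riccStep A C 1 1 g X).PosSemidef := by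
  rcases hg with rfl | rfl
  · rw [hK rfl]
    simp [riccStep, PosSemidef.zero]
  · obtain ⟨h, hW⟩ := ricc_le_aux A C X hX K
    rw [h]
    exact hW.posSemidef.mul_mul_conjTranspose_same _

lemma ricc_eq {ι κ : Type} [Fintype ι] [Fintype κ] [DecidableEq ι] [DecidableEq κ]
    (A : Matrix ι ι ℂ) (C : Matrix κ ι ℂ) (X : Matrix ι ι ℂ) (hX : X.PosSemidef)
    (g : ℝ) (hg : g = 0 ∨ g = 1) : ∃ K : Matrix ι κ ℂ, (g = 0 → K = 0) ∧
    riccStep A C 1 1 g X = (A + K * C) * X * (A + K * C)ᴴ + 1 + K * Kᴴ := by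
  rcases hg with rfl | rfl
  · exact ⟨0, fun _ => rfl, by simp [riccStep]⟩
  · refine ⟨-(A * X * Cᴴ * (C * X * Cᴴ + 1)⁻¹), by simp, ?_⟩
    obtain ⟨h, -⟩ := ricc_le_aux A C X hX (-(A * X * Cᴴ * (C * X * Cᴴ + 1)⁻¹))
    rw [neg_add_cancel, Matrix.zero_mul, Matrix.zero_mul, sub_eq_zero] at h
    exact h.symm

lemma ricc_psd {ι κ : Type} [Fintype ι] [Fintype κ] [DecidableEq ι] [DecidableEq κ]
    (A : Matrix ι ι ℂ) (C : Matrix κ ι ℂ) (X : Matrix ι ι ℂ) (hX : X.PosSemidef)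
    (g : ℕ → ℝ) (hg : ∀ k, g k = 0 ∨ g k = 1) (k : ℕ) : (ricc A C 1 1 X g k).PosSemidef := by
  induction k with
  | zero => exact hX
  | succ k ih =>
    obtain ⟨K, -, h⟩ := ricc_eq A C _ ih (g k) (hg k)
    rw [ricc, h]
    exact ((ih.mul_mul_conjTranspose_same _).add PosSemidef.one).add
      (posSemidef_self_mul_conjTranspose K)

lemma ricc_simple {Ω ι κ : Type} [Fintype ι] [Fintype κ] [DecidableEq ι] [DecidableEq κ]
    [MeasurableSpace Ω] (γ : ℕ → Ω → ℝ) (hmeas : ∀ k, Measurable (γ k))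
    (h01 : ∀ k ω, γ k ω = 0 ∨ γ k ω = 1)
    (A : Matrix ι ι ℂ) (C : Matrix κ ι ℂ) (X : Matrix ι ι ℂ) (k : ℕ) :
    ∃ f : SimpleFunc Ω (Matrix ι ι ℂ), ∀ ω, ricc A C 1 1 X (fun i => γ i ω) k = f ω := by
  induction k with
  | zero => exact ⟨SimpleFunc.const Ω X, fun ω => rfl⟩
  | succ k ih =>
    obtain ⟨f, hf⟩ := ih
    let g : SimpleFunc Ω ℝ := ⟨γ k, fun x => hmeas k (measurableSet_singleton x), by
      refine (Set.toFinite ({0, 1} : Set ℝ)).subset ?_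
      rintro _ ⟨ω, rfl⟩
      exact h01 k ω⟩
    refine ⟨(g.pair f).map (fun z => riccStep A C 1 1 z.1 z.2), fun ω => ?_⟩
    rw [ricc, hf]
    rfl

lemma ricc_integrable {Ω ι κ : Type} [Fintype ι] [Fintype κ] [DecidableEq ι] [DecidableEq κ]
    [MeasurableSpace Ω] (μ : Measure Ω) [IsProbabilityMeasure μ]
    (γ : ℕ → Ω → ℝ) (hmeas : ∀ k, Measurable (γ k))
    (h01 : ∀ k ω, γ k ω = 0 ∨ γ k ω = 1)
    (A : Matrix ι ι ℂ) (C : Matrix κ ι ℂ) (X : Matrix ι ι ℂ) (k : ℕ) (i j : ι) :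
    Integrable (fun ω => ricc A C 1 1 X (fun i => γ i ω) k i j) μ := by
  obtain ⟨f, hf⟩ := ricc_simple γ hmeas h01 A C X k
  simp only [hf]
  exact SimpleFunc.integrable_of_isFiniteMeasure (μ := μ) (f.map (fun M => M i j))

lemma young {ι κ : Type} [Fintype ι] [Fintype κ] (X Y : Matrix ι κ ℂ) (s : ℝ) (hs : 0 < s) :
    (((1 + s ^ 2 : ℝ) : ℂ) • (X * Xᴴ) + ((1 + (s⁻¹) ^ 2 : ℝ) : ℂ) • (Y * Yᴴ)
      - (X + Y) * (X + Y)ᴴ).PosSemidef := by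
  have h := posSemidef_self_mul_conjTranspose ((s : ℂ) • X - ((s⁻¹ : ℝ) : ℂ) • Y)
  convert h using 1
  have hsc : (s : ℂ) ≠ 0 := by exact_mod_cast hs.ne'
  simp only [conjTranspose_add, conjTranspose_sub, conjTranspose_smul, Matrix.mul_add,
    Matrix.add_mul, Matrix.mul_sub, Matrix.sub_mul, Matrix.mul_smul, Matrix.smul_mul,
    Complex.star_def, Complex.conj_ofReal]
  push_cast
  simp only [smul_sub, smul_smul]
  rw [mul_inv_cancel₀ hsc, inv_mul_cancel₀ hsc]
  module

lemma psd_smul {ι : Type} [Fintype ι] {X : Matrix ι ι ℂ} (hX : X.PosSemidef) {r : ℝ}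
    (hr : 0 ≤ r) : ((r : ℂ) • X).PosSemidef :=
  hX.smul (by exact_mod_cast hr)

lemma key_step {ι υ κ : Type} [Fintype ι] [Fintype υ] [Fintype κ] [DecidableEq ι] [DecidableEq υ]
    [DecidableEq κ] (A : Matrix ι ι ℂ) (C : Matrix κ ι ℂ) (B : Matrix υ υ ℂ) (D : Matrix κ υ ℂ)
    (E : Matrix ι υ ℂ) (J : Matrix ι ι ℂ) (α s b c d q : ℝ)
    (hJ : J.PosSemidef) (hJ2 : J * J = J) (hE : E * Eᴴ + J = 1) (hAE : A * E = E * B)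
    (hCE : C * E = D) (hα : 1 < α) (hs : 0 < s) (hd : 0 ≤ d)
    (hAJ : ((q : ℂ) • J - A * J * (A * J)ᴴ).PosSemidef)
    (hCJ : ((b : ℂ) • 1 - C * J * (C * J)ᴴ).PosSemidef)
    (hq : 1 + d * ((1 + s ^ 2) * q) ≤ d) (hc1 : 1 ≤ c)
    (hc : 1 + d * ((1 + (s⁻¹) ^ 2) * b) ≤ c)
    (g : ℝ) (hg : g = 0 ∨ g = 1) (P : Matrix ι ι ℂ) (S : Matrix υ υ ℂ) (hP : P.PosSemidef)
    (hS : S.PosSemidef) (h : ((c : ℂ) • (E * S * Eᴴ) + (d : ℂ) • J - P).PosSemidef) :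
    ((c : ℂ) • (E * riccStep ((α : ℂ) • B) D 1 1 g S * Eᴴ) + (d : ℂ) • J
      - riccStep A C 1 1 g P).PosSemidef := by
  obtain ⟨Kα, hK0, hKe⟩ := ricc_eq ((α : ℂ) • B) D S hS g hg
  set L := ((α⁻¹ : ℝ) : ℂ) • Kα with hL
  have hα0 : (α : ℂ) ≠ 0 := by exact_mod_cast (by linarith : α ≠ 0)
  have hKL : Kα = (α : ℂ) • L := by
    rw [hL, smul_smul]; push_cast; rw [mul_inv_cancel₀ hα0, one_smul]
  set F := B + L * D with hF
  have hSe : riccStep ((α : ℂ) • B) D 1 1 g S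
      = ((α ^ 2 : ℝ) : ℂ) • (F * S * Fᴴ) + 1 + ((α ^ 2 : ℝ) : ℂ) • (L * Lᴴ) := by
    rw [hKe, hKL, Matrix.smul_mul, ← smul_add, ← hF]
    simp only [conjTranspose_smul, Matrix.smul_mul, Matrix.mul_smul, smul_smul,
      Complex.star_def, Complex.conj_ofReal]
    push_cast
    rw [pow_two]
  have t1 := ricc_le A C P hP g hg (E * L) (fun h0 => by rw [hL, hK0 h0]; simp)
  set G := A + E * L * C with hG
  have t2 := h.mul_mul_conjTranspose_same G
  have hGE : G * E = E * F := by
    rw [hG, hF, Matrix.add_mul, Matrix.mul_add, hAE, Matrix.mul_assoc _ C E, hCE, Matrix.mul_assoc]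
  have hGJ : G * J = A * J + E * L * (C * J) := by
    rw [hG, Matrix.add_mul, Matrix.mul_assoc _ C]
  have eZ : G * ((c : ℂ) • (E * S * Eᴴ) + (d : ℂ) • J) * Gᴴ =
      (c : ℂ) • (E * (F * S * Fᴴ) * Eᴴ) + (d : ℂ) • (G * J * (G * J)ᴴ) := by
    have a1 : G * (E * S * Eᴴ) * Gᴴ = E * (F * S * Fᴴ) * Eᴴ := by
      calc _ = (G * E) * S * (G * E)ᴴ := by simp only [conjTranspose_mul, Matrix.mul_assoc]
        _ = _ := by rw [hGE]; simp only [conjTranspose_mul, Matrix.mul_assoc]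
    have a2 : G * J * Gᴴ = G * J * (G * J)ᴴ := by
      rw [conjTranspose_mul, hJ.isHermitian.eq, Matrix.mul_assoc G J (J * Gᴴ),
        ← Matrix.mul_assoc J J, hJ2, Matrix.mul_assoc]
    rw [Matrix.mul_add, Matrix.add_mul, Matrix.mul_smul, Matrix.smul_mul, a1, Matrix.mul_smul,
      Matrix.smul_mul, a2]
  have t3 := psd_smul (young (A * J) (E * L * (C * J)) s hs) hd
  rw [← hGJ] at t3
  have t4 := psd_smul hAJ (r := d * (1 + s ^ 2)) (by positivity)
  have t5 := psd_smul (hCJ.mul_mul_conjTranspose_same (E * L)) (r := d * (1 + (s⁻¹) ^ 2))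
    (by positivity)
  have eY : E * L * ((b : ℂ) • 1 - C * J * (C * J)ᴴ) * (E * L)ᴴ =
      (b : ℂ) • (E * L * (E * L)ᴴ) - E * L * (C * J) * (E * L * (C * J))ᴴ := by
    rw [Matrix.mul_sub, Matrix.sub_mul, Matrix.mul_smul, Matrix.smul_mul, Matrix.mul_one,
      conjTranspose_mul (E * L) (C * J)]
    simp only [Matrix.mul_assoc]
  rw [eY] at t5
  have t6 := psd_smul hJ (r := d - (1 + d * ((1 + s ^ 2) * q))) (by linarith)
  have t7 := psd_smul (posSemidef_self_mul_conjTranspose (E * L))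
    (r := c - (1 + d * ((1 + (s⁻¹) ^ 2) * b))) (by linarith)
  have t8 := psd_smul (posSemidef_self_mul_conjTranspose E) (r := c - 1) (by linarith)
  have hα2 : 0 ≤ c * (α ^ 2 - 1) := mul_nonneg (by linarith) (by nlinarith)
  have t9 := psd_smul (posSemidef_self_mul_conjTranspose (E * L)) hα2
  have t10 := psd_smul ((hS.mul_mul_conjTranspose_same F).mul_mul_conjTranspose_same E) hα2
  rw [Matrix.mul_sub, Matrix.sub_mul, eZ] at t2
  rw [hSe]
  have eS : E * (((α ^ 2 : ℝ) : ℂ) • (F * S * Fᴴ) + 1 + ((α ^ 2 : ℝ) : ℂ) • (L * Lᴴ)) * Eᴴ =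
      ((α ^ 2 : ℝ) : ℂ) • (E * (F * S * Fᴴ) * Eᴴ) + E * Eᴴ +
      ((α ^ 2 : ℝ) : ℂ) • (E * L * (E * L)ᴴ) := by
    rw [Matrix.mul_add, Matrix.add_mul, Matrix.mul_add, Matrix.add_mul, Matrix.mul_smul,
      Matrix.smul_mul, Matrix.mul_one, Matrix.mul_smul, Matrix.smul_mul, conjTranspose_mul]
    simp only [Matrix.mul_assoc]
  rw [eS]
  generalize riccStep A C 1 1 g P = Y at t1 ⊢
  rw [← hE] at t1
  have := ((((((((t1.add t2).add t3).add t4).add t5).add t6).add t7).add t8).add t9).add t10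
  convert this using 1
  push_cast
  module

/-- stable modes do not increase the critical value.  If for some `α > 1` the
subsystem `(diag(αA₁, αA₂), [C₁ C₂])` (unstable and critically stable modes, inflated by `α`)
has bounded expected error covariance for all PSD initial conditions at arrival probability `p`,
then so does the full system `(diag(A₁,A₂,A₃), [C₁ C₂ C₃])`. -/
theorem stmt7 {n1 n2 n3 m : ℕ}
    (d1 : Fin n1 → ℂ) (d2 : Fin n2 → ℂ) (d3 : Fin n3 → ℂ)
    (h1 : ∀ i, 1 < ‖d1 i‖)
    (h2 : ∀ i, ‖d2 i‖ = 1)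
    (h3 : ∀ i, ‖d3 i‖ < 1)
    (C : Matrix (Fin m) (Fin n1 ⊕ (Fin n2 ⊕ Fin n3)) ℂ)
    (hdet : Detectable (Matrix.diagonal (Sum.elim d1 (Sum.elim d2 d3))) C)
    {Ω : Type} [MeasurableSpace Ω] (μ : Measure Ω) [IsProbabilityMeasure μ]
    (γ : ℕ → Ω → ℝ) (p : ℝ)
    (hmeas : ∀ k, Measurable (γ k))
    (hind : iIndepFun γ μ)
    (h01 : ∀ k ω, γ k ω = 0 ∨ γ k ω = 1)
    (hber : ∀ k, μ {ω | γ k ω = 1} = ENNReal.ofReal p)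
    (C12 : Matrix (Fin m) (Fin n1 ⊕ Fin n2) ℂ)
    (hC12 : C12 = C.submatrix id (Sum.map id Sum.inl))
    (hprem : ∃ α : ℝ, 1 < α ∧
      ∀ S0 : Matrix (Fin n1 ⊕ Fin n2) (Fin n1 ⊕ Fin n2) ℂ, S0.PosSemidef →
        EBounded μ (fun k ω =>
          ricc (Matrix.diagonal fun x => (α : ℂ) * Sum.elim d1 d2 x) C12 1 1 S0
            (fun i => γ i ω) k)) :
    ∀ S0 : Matrix (Fin n1 ⊕ (Fin n2 ⊕ Fin n3)) (Fin n1 ⊕ (Fin n2 ⊕ Fin n3)) ℂ,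
      S0.PosSemidef →
      EBounded μ (fun k ω =>
        ricc (Matrix.diagonal (Sum.elim d1 (Sum.elim d2 d3))) C 1 1 S0
          (fun i => γ i ω) k) := by
  intro S0 hS0
  obtain ⟨α, hα, hprem⟩ := hprem
  refine ⟨fun k i j => ricc_integrable μ γ hmeas h01 _ _ _ _ _ _, ?_⟩
  -- constants
  obtain ⟨q, hq0, hq1, hqd⟩ : ∃ q : ℝ, 0 ≤ q ∧ q < 1 ∧ ∀ i, ‖d3 i‖ ^ 2 ≤ q := by
    by_cases hn : Nonempty (Fin n3)
    · obtain ⟨i0, hi0⟩ := Finite.exists_max (fun i => ‖d3 i‖ ^ 2)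
      exact ⟨_, by positivity, by have := h3 i0; have := norm_nonneg (d3 i0); nlinarith, hi0⟩
    · exact ⟨0, le_rfl, one_pos, fun i => (hn ⟨i⟩).elim⟩
  obtain ⟨s, hs, hsq⟩ : ∃ s : ℝ, 0 < s ∧ (1 + s ^ 2) * q < 1 := by
    refine ⟨Real.sqrt ((1 - q) / 2), Real.sqrt_pos.2 (by linarith), ?_⟩
    rw [Real.sq_sqrt (by linarith)]
    nlinarith
  set A := Matrix.diagonal (Sum.elim d1 (Sum.elim d2 d3)) with hA
  let Pi : Matrix (Fin n1 ⊕ (Fin n2 ⊕ Fin n3)) (Fin n1 ⊕ (Fin n2 ⊕ Fin n3)) ℂ :=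
    Matrix.diagonal (Sum.elim (fun _ => 0) (Sum.elim (fun _ => 0) (fun _ => 1)))
  let E : Matrix (Fin n1 ⊕ (Fin n2 ⊕ Fin n3)) (Fin n1 ⊕ Fin n2) ℂ :=
    (1 : Matrix (Fin n1 ⊕ (Fin n2 ⊕ Fin n3)) (Fin n1 ⊕ (Fin n2 ⊕ Fin n3)) ℂ).submatrix id (Sum.map id Sum.inl)
  have hPi : Pi.PosSemidef := by
    apply PosSemidef.diagonal
    rintro (i | i | i) <;> simp
  have hPi2 : Pi * Pi = Pi := by
    simp only [Pi, diagonal_mul_diagonal]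
    congr 1; ext (i | i | i) <;> simp
  have hE : E * Eᴴ + Pi = 1 := by
    ext (i | i | i) (j | j | j) <;>
      simp [E, Pi, Matrix.mul_apply, Matrix.one_apply, Matrix.diagonal_apply, eq_comm]
  have hAE : A * E = E * Matrix.diagonal (Sum.elim d1 d2) := by
    ext (i | i | i) (j | j) <;>
      simp [hA, E, Matrix.one_apply] <;> aesop
  have hCE : C * E = C12 := by
    rw [hC12]
    ext i (j | j) <;> simp [E, Matrix.mul_apply, Matrix.one_apply]
  obtain ⟨b, hb0, hb⟩ := loew_bound (C * Pi * (C * Pi)ᴴ)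
    (posSemidef_self_mul_conjTranspose _).isHermitian
  obtain ⟨t, ht0, ht⟩ := loew_bound S0 hS0.isHermitian
  set d : ℝ := max t (1 / (1 - (1 + s ^ 2) * q)) with hd
  have hd0 : 0 ≤ d := ht0.trans (le_max_left _ _)
  have hdq : 1 + d * ((1 + s ^ 2) * q) ≤ d := by
    have h5 : 1 / (1 - (1 + s ^ 2) * q) ≤ d := le_max_right _ _
    rw [div_le_iff₀ (by linarith)] at h5
    linarith
  set c : ℝ := 1 + d * ((1 + (s⁻¹) ^ 2) * b) with hc
  have hc1 : 1 ≤ c := by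
    have : 0 ≤ d * ((1 + (s⁻¹) ^ 2) * b) := by positivity
    linarith
  have hAPi : ((q : ℂ) • Pi - A * Pi * (A * Pi)ᴴ).PosSemidef := by
    simp only [hA, Pi, diagonal_mul_diagonal, diagonal_conjTranspose, ← diagonal_smul, diagonal_sub]
    apply PosSemidef.diagonal
    rintro (i | i | i)
    · simp
    · simp
    · have h6 := hqd i
      simp [Complex.mul_conj, Complex.normSq_eq_norm_sq]
      exact_mod_cast h6
  have hα' : (Matrix.diagonal fun x => (α : ℂ) * Sum.elim d1 d2 x) =
      (α : ℂ) • Matrix.diagonal (Sum.elim d1 d2) := by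
    rw [← diagonal_smul]; rfl
  rw [hα'] at hprem
  have hT : ((d : ℂ) • (1 : Matrix (Fin n1 ⊕ Fin n2) (Fin n1 ⊕ Fin n2) ℂ)).PosSemidef :=
    psd_smul PosSemidef.one hd0
  obtain ⟨hint, M, hM, hMb⟩ := hprem _ hT
  have main : ∀ k ω, ((c : ℂ) • (E * ricc ((α : ℂ) • Matrix.diagonal (Sum.elim d1 d2)) C12 1 1
      ((d : ℂ) • 1) (fun i => γ i ω) k * Eᴴ) + (d : ℂ) • Pi
      - ricc A C 1 1 S0 (fun i => γ i ω) k).PosSemidef := by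
    intro k ω
    induction k with
    | zero =>
      have t1 := ht d (le_max_left _ _)
      have t2 := psd_smul (posSemidef_self_mul_conjTranspose E) (r := (c - 1) * d)
        (mul_nonneg (by linarith) hd0)
      rw [← hE] at t1
      convert t1.add t2 using 1
      simp only [ricc, Matrix.mul_smul, Matrix.smul_mul, Matrix.mul_one]
      push_cast
      module
    | succ k ih =>
      exact key_step A C _ C12 E Pi α s b c d q hPi hPi2 hE hAE hCE hα hs hd0 hAPi
        (hb b le_rfl) hdq hc1 le_rfl (γ k ω) (h01 k ω) _ _
        (ricc_psd A C S0 hS0 _ (fun k => h01 k ω) k)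
        (ricc_psd _ C12 _ hT _ (fun k => h01 k ω) k) ih
  refine ⟨(c : ℂ) • (E * M * Eᴴ) + (d : ℂ) • Pi, ?_, fun k => ?_⟩
  · have : (E * M * Eᴴ).IsHermitian := isHermitian_mul_mul_conjTranspose E hM
    unfold Matrix.IsHermitian
    rw [conjTranspose_add, conjTranspose_smul, conjTranspose_smul, this.eq, hPi.isHermitian.eq]
    simp
  · unfold loe
    set S := fun ω => ricc ((α : ℂ) • Matrix.diagonal (Sum.elim d1 d2)) C12 1 1
      ((d : ℂ) • 1) (fun i => γ i ω) k with hSdef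
    set P := fun ω => ricc A C 1 1 S0 (fun i => γ i ω) k with hPdef
    have hSi : ∀ i j, Integrable (fun ω => S ω i j) μ := fun i j => hint k i j
    have hPi' : ∀ i j, Integrable (fun ω => P ω i j) μ :=
      fun i j => ricc_integrable μ γ hmeas h01 _ _ _ _ _ _
    have hESi : ∀ i j, Integrable (fun ω => (E * S ω * Eᴴ) i j) μ := by
      intro i j
      simp only [Matrix.mul_apply]
      exact integrable_finsetSum _ fun a _ =>
        (integrable_finsetSum _ fun e _ => (hSi e a).const_mul _).mul_const _
    have hES : matExp μ (fun ω => E * S ω * Eᴴ) = E * matExp μ S * Eᴴ := by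
      ext i j
      simp only [Matrix.mul_apply, matExp, Matrix.of_apply]
      rw [integral_finsetSum]
      · refine Finset.sum_congr rfl fun a _ => ?_
        rw [integral_mul_const, integral_finsetSum]
        · congr 1
          exact Finset.sum_congr rfl fun e _ => integral_const_mul _ _
        · exact fun e _ => (hSi e a).const_mul _
      · exact fun a _ =>
          (integrable_finsetSum _ fun e _ => (hSi e a).const_mul _).mul_const _
    have hZi : ∀ i j, Integrable (fun ω => ((c : ℂ) • (E * S ω * Eᴴ) + (d : ℂ) • Pi) i j) μ :=
      fun i j => ((hESi i j).const_mul (c : ℂ)).add (integrable_const _)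
    have e1 := matExp_psd μ (fun ω => (c : ℂ) • (E * S ω * Eᴴ) + (d : ℂ) • Pi - P ω)
      (fun i j => (hZi i j).sub (hPi' i j)) (fun ω => main k ω)
    have e2 : matExp μ (fun ω => (c : ℂ) • (E * S ω * Eᴴ) + (d : ℂ) • Pi - P ω) =
        (c : ℂ) • (E * matExp μ S * Eᴴ) + (d : ℂ) • Pi - matExp μ P := by
      rw [← hES]
      ext i j
      have : ∫ ω, ((c : ℂ) * (E * S ω * Eᴴ) i j + (d : ℂ) * Pi i j) - P ω i j ∂μ =
          (c : ℂ) * ∫ ω, (E * S ω * Eᴴ) i j ∂μ + (d : ℂ) * Pi i j - ∫ ω, P ω i j ∂μ := by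
        have hZ2 : Integrable (fun ω => (c : ℂ) * (E * S ω * Eᴴ) i j + (d : ℂ) * Pi i j) μ :=
          hZi i j
        rw [integral_sub hZ2 (hPi' i j),
          integral_add ((hESi i j).const_mul (c : ℂ)) (integrable_const _), integral_const_mul]
        simp
      exact this
    rw [e2] at e1
    have e3 := psd_smul ((hMb k).mul_mul_conjTranspose_same E) (r := c) (by linarith)
    convert e3.add e1 using 1
    rw [Matrix.mul_sub, Matrix.sub_mul]
    module
end

section
/- Let A = diag(λ₁,…,λ_n) be a diagonal n×n complex matrix with |λ₁| ≥ |λ₂| ≥ … ≥ |λ_n| > 1, and for k ∈ ℕ let F_k be the n(k+1) × n(k+1) block lower-triangular matrix whose (i,j)-th n×n block (1 ≤ i, j ≤ k+1) equals A^{−(i−j+1)} when i ≥ j and 0 when i < j. Then (1/(|λ₁|+1)²) · I ≤ F_k F_k* ≤ (1/(|λ_n|−1)²) · I in the Loewner order. -/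
open Matrix MeasureTheory ProbabilityTheory
open scoped ComplexOrder ENNReal

lemma scal_aux (c : ℂ) (hc : 1 < ‖c‖) (k : ℕ) (X Y : ℕ → ℂ)
    (h0 : Y (k + 1) = 0) (hr : ∀ q ∈ Finset.range (k + 1), X q = c * Y q - Y (q + 1)) :
    (∑ q ∈ Finset.range (k + 1), ‖X q‖ ^ 2 ≤
      (‖c‖ + 1) ^ 2 * ∑ q ∈ Finset.range (k + 1), ‖Y q‖ ^ 2) ∧
    ((‖c‖ - 1) ^ 2 * ∑ q ∈ Finset.range (k + 1), ‖Y q‖ ^ 2 ≤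
      ∑ q ∈ Finset.range (k + 1), ‖X q‖ ^ 2) := by
  have hs : ∑ q ∈ Finset.range (k + 1), ‖Y (q + 1)‖ ^ 2 ≤
      ∑ q ∈ Finset.range (k + 1), ‖Y q‖ ^ 2 := by
    have h1 := Finset.sum_range_succ (fun q => ‖Y q‖ ^ 2) (k + 1)
    have h2 := Finset.sum_range_succ' (fun q => ‖Y q‖ ^ 2) (k + 1)
    simp only [h0, norm_zero] at h1
    nlinarith [sq_nonneg ‖Y 0‖]
  constructor
  · have : ∑ q ∈ Finset.range (k + 1), ‖X q‖ ^ 2 ≤ ∑ q ∈ Finset.range (k + 1),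
        ((‖c‖ ^ 2 + ‖c‖) * ‖Y q‖ ^ 2 + (‖c‖ + 1) * ‖Y (q + 1)‖ ^ 2) := by
      apply Finset.sum_le_sum
      intro q hq
      have h1 : ‖X q‖ ≤ ‖c‖ * ‖Y q‖ + ‖Y (q + 1)‖ := by
        rw [hr q hq, ← norm_mul]; exact norm_sub_le _ _
      have h2 := pow_le_pow_left₀ (norm_nonneg _) h1 2
      nlinarith [mul_nonneg (norm_nonneg c) (sq_nonneg (‖Y q‖ - ‖Y (q + 1)‖))]
    rw [Finset.sum_add_distrib, ← Finset.mul_sum, ← Finset.mul_sum] at this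
    nlinarith
  · have : ∑ q ∈ Finset.range (k + 1),
        ((‖c‖ ^ 2 - ‖c‖) * ‖Y q‖ ^ 2 - (‖c‖ - 1) * ‖Y (q + 1)‖ ^ 2) ≤
        ∑ q ∈ Finset.range (k + 1), ‖X q‖ ^ 2 := by
      apply Finset.sum_le_sum
      intro q hq
      have h1 : |‖c‖ * ‖Y q‖ - ‖Y (q + 1)‖| ≤ ‖X q‖ := by
        rw [hr q hq, ← norm_mul]; exact abs_norm_sub_norm_le _ _
      have h2 := pow_le_pow_left₀ (abs_nonneg _) h1 2
      rw [sq_abs] at h2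
      nlinarith [mul_nonneg (norm_nonneg c) (sq_nonneg (‖Y q‖ - ‖Y (q + 1)‖))]
    rw [Finset.sum_sub_distrib, ← Finset.mul_sum, ← Finset.mul_sum] at this
    nlinarith

lemma scal_fin (c : ℂ) (hc : 1 < ‖c‖) (k : ℕ) (x : Fin (k + 1) → ℂ) :
    (∑ q, ‖x q‖ ^ 2 ≤ (‖c‖ + 1) ^ 2 * ∑ q : Fin (k + 1),
      ‖∑ p : Fin (k + 1), if (q : ℕ) ≤ p then c⁻¹ ^ ((p : ℕ) - q + 1) * x p else 0‖ ^ 2) ∧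
    ((‖c‖ - 1) ^ 2 * ∑ q : Fin (k + 1),
      ‖∑ p : Fin (k + 1), if (q : ℕ) ≤ p then c⁻¹ ^ ((p : ℕ) - q + 1) * x p else 0‖ ^ 2 ≤
      ∑ q, ‖x q‖ ^ 2) := by
  have hc0 : c ≠ 0 := by rintro rfl; simp at hc; linarith
  set Y : ℕ → ℂ := fun q =>
    ∑ p : Fin (k + 1), if q ≤ (p : ℕ) then c⁻¹ ^ ((p : ℕ) - q + 1) * x p else 0 with hY
  set X : ℕ → ℂ := fun q => if h : q < k + 1 then x ⟨q, h⟩ else 0 with hX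
  have h0 : Y (k + 1) = 0 := by
    apply Finset.sum_eq_zero
    intro p _
    rw [if_neg (by have := p.2; omega)]
  have := scal_aux c hc k X Y h0 (by
    intro q hq
    have hq' := Finset.mem_range.1 hq
    rw [eq_sub_iff_add_eq]
    have e : X q = ∑ p : Fin (k + 1), if p = ⟨q, hq'⟩ then x p else 0 := by
      rw [Finset.sum_ite_eq' Finset.univ, if_pos (Finset.mem_univ _)]
      simp only [hX, dif_pos hq']
    rw [e]
    simp only [hY]
    rw [Finset.mul_sum, ← Finset.sum_add_distrib]
    apply Finset.sum_congr rfl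
    intro p _
    rcases lt_trichotomy (p : ℕ) q with h | h | h
    · rw [if_neg (by rintro rfl; simp at h), if_neg (by omega), if_neg (by omega)]; simp
    · have : p = ⟨q, hq'⟩ := Fin.ext h
      rw [if_pos this, if_neg (by omega), if_pos (by omega), h]
      simp [hc0]
    · rw [if_neg (by rintro rfl; simp at h), if_pos (by omega), if_pos (by omega)]
      rw [show (p : ℕ) - q + 1 = ((p : ℕ) - (q + 1) + 1) + 1 by omega, pow_succ _ (_ + 1)]
      field_simp
      simp)
  have hXx : ∀ q : Fin (k + 1), X q = x q := fun q => by simp only [hX, dif_pos q.2]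
  rw [Finset.sum_range, Finset.sum_range] at this
  simp only [hXx] at this
  exact this

/-- Loewner bounds `(|λ₁|+1)⁻² I ≤ F_k F_kᴴ ≤ (|λ_n|−1)⁻² I` for the block
lower-triangular matrix `F_k` with blocks `A^{−(i−j+1)}` (for `i ≥ j`). -/
theorem stmt9 {n : ℕ} (d : Fin (n + 1) → ℂ)
    (hsort : ∀ i j : Fin (n + 1), i ≤ j → ‖d j‖ ≤ ‖d i‖)
    (hunst : 1 < ‖d (Fin.last n)‖)
    (k : ℕ)
    (F : Matrix (Fin (k + 1) × Fin (n + 1)) (Fin (k + 1) × Fin (n + 1)) ℂ)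
    (hF : F = Matrix.of fun p q =>
      if (q.1 : ℕ) ≤ (p.1 : ℕ) then
        ((Matrix.diagonal d)⁻¹ ^ ((p.1 : ℕ) - (q.1 : ℕ) + 1)) p.2 q.2
      else 0) :
    loe ((((1 : ℝ) / (‖d 0‖ + 1) ^ 2 : ℝ) : ℂ) •
        (1 : Matrix (Fin (k + 1) × Fin (n + 1)) (Fin (k + 1) × Fin (n + 1)) ℂ)) (F * Fᴴ) ∧
    loe (F * Fᴴ) ((((1 : ℝ) / (‖d (Fin.last n)‖ - 1) ^ 2 : ℝ) : ℂ) •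
        (1 : Matrix (Fin (k + 1) × Fin (n + 1)) (Fin (k + 1) × Fin (n + 1)) ℂ)) := by
  have hd : ∀ a, 1 < ‖d a‖ := fun a => hunst.trans_le (hsort _ _ (Fin.le_last a))
  have hinv : (Matrix.diagonal d)⁻¹ = Matrix.diagonal (fun a => (d a)⁻¹) := by
    apply Matrix.inv_eq_right_inv
    rw [Matrix.diagonal_mul_diagonal, ← Matrix.diagonal_one]
    congr 1
    funext a
    have : d a ≠ 0 := by
      intro h; have := hd a; rw [h] at this; simp at this; linarith
    simp [this]
  have hy : ∀ (x : Fin (k + 1) × Fin (n + 1) → ℂ) (q : Fin (k + 1)) (a : Fin (n + 1)),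
      (Fᴴ *ᵥ x) (q, a) = ∑ p : Fin (k + 1),
        if (q : ℕ) ≤ p then (star (d a))⁻¹ ^ ((p : ℕ) - q + 1) * x (p, a) else 0 := by
    intro x q a
    rw [hF, hinv]
    simp only [Matrix.mulVec, dotProduct, Fintype.sum_prod_type, Matrix.conjTranspose_apply,
      Matrix.of_apply, Matrix.diagonal_pow]
    apply Finset.sum_congr rfl
    intro p _
    split_ifs with h
    · rw [Finset.sum_eq_single a]
      · simp
      · intro b _ hb
        simp [Matrix.diagonal_apply_ne _ hb]
      · simp
    · simp
  have hn : ∀ x : Fin (k + 1) × Fin (n + 1) → ℂ,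
      star x ⬝ᵥ x = ((∑ a, ∑ q, ‖x (q, a)‖ ^ 2 : ℝ) : ℂ) := by
    intro x
    rw [dotProduct, Fintype.sum_prod_type, Finset.sum_comm]
    push_cast
    refine Finset.sum_congr rfl fun a _ => Finset.sum_congr rfl fun q _ => ?_
    simp [Complex.conj_mul']
  have hq : ∀ x : Fin (k + 1) × Fin (n + 1) → ℂ,
      star x ⬝ᵥ ((F * Fᴴ) *ᵥ x) = ((∑ a, ∑ q, ‖(Fᴴ *ᵥ x) (q, a)‖ ^ 2 : ℝ) : ℂ) := by
    intro x
    rw [← hn, ← Matrix.mulVec_mulVec, Matrix.dotProduct_mulVec, Matrix.star_mulVec,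
      Matrix.conjTranspose_conjTranspose]
  have hherm : (F * Fᴴ).IsHermitian := Matrix.isHermitian_mul_conjTranspose_self F
  have hs1 : ∀ r : ℝ, ((r : ℂ) • (1 : Matrix (Fin (k + 1) × Fin (n + 1))
      (Fin (k + 1) × Fin (n + 1)) ℂ)).IsHermitian := by
    intro r
    rw [Matrix.IsHermitian, Matrix.conjTranspose_smul]
    simp
  have hstar : ∀ a, 1 < ‖star (d a)‖ := fun a => by rw [norm_star]; exact hd a
  constructor
  · refine Matrix.PosSemidef.of_dotProduct_mulVec_nonneg (hherm.sub (hs1 _)) fun x => ?_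
    rw [Matrix.sub_mulVec, dotProduct_sub, hq, Matrix.smul_mulVec, Matrix.one_mulVec,
      dotProduct_smul, hn, smul_eq_mul, ← Complex.ofReal_mul, ← Complex.ofReal_sub,
      Complex.zero_le_real, sub_nonneg, Finset.mul_sum]
    refine Finset.sum_le_sum fun a _ => ?_
    have h := (scal_fin (star (d a)) (hstar a) k (fun q => x (q, a))).1
    simp only [← hy, norm_star] at h
    rw [one_div, inv_mul_le_iff₀ (by positivity)]
    refine h.trans ?_
    gcongr
    exact hsort _ _ (Fin.zero_le a)
  · refine Matrix.PosSemidef.of_dotProduct_mulVec_nonneg ((hs1 _).sub hherm) fun x => ?_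
    rw [Matrix.sub_mulVec, dotProduct_sub, hq, Matrix.smul_mulVec, Matrix.one_mulVec,
      dotProduct_smul, hn, smul_eq_mul, ← Complex.ofReal_mul, ← Complex.ofReal_sub,
      Complex.zero_le_real, sub_nonneg, Finset.mul_sum]
    refine Finset.sum_le_sum fun a _ => ?_
    have h := (scal_fin (star (d a)) (hstar a) k (fun q => x (q, a))).2
    simp only [← hy, norm_star] at h
    have hp : 0 < ‖d (Fin.last n)‖ - 1 := by linarith
    rw [one_div, le_inv_mul_iff₀ (by positivity)]
    refine le_trans ?_ h
    gcongr
    exact hsort _ _ (Fin.le_last a)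
end

section
/- Let λ₁,…,λ_n ∈ ℂ be nonzero with |λ₁| ≥ |λ₂| ≥ … ≥ |λ_n|, and let l_{a,b} ∈ ℂ (1 ≤ a,b ≤ n) satisfy l_{a,a} = 1 for all a and l_{a,b} = 0 whenever a ≠ b and |λ_a| = |λ_b|. For positive integers i₁ < i₂ < … < i_n define D(i₁,…,i_n) = det of the n×n matrix whose (a,b)-entry is l_{a,b} · λ_b^{−i_a}, and set Δi₁ = i₁, Δi_j = i_j − i_{j−1} for j ≥ 2. Then D(i₁,…,i_n) / (∏_{b=1}^n λ_b^{−i_b}) → 1 as all the gaps tend to infinity; precisely, for every ε > 0 there exists N such that whenever Δi_j ≥ N for all j = 1,…,n, one has |D(i₁,…,i_n) / ∏_{b=1}^n λ_b^{−i_b} − 1| < ε. -/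
open Matrix MeasureTheory ProbabilityTheory
open scoped ComplexOrder ENNReal

theorem aux_tendsto {n : ℕ} (c : Fin (n + 1) → ℝ) (hc : Monotone c)
    (l : Fin (n + 1) → Fin (n + 1) → ℂ)
    (hzero : ∀ a b, a ≠ b → c a = c b → l a b = 0)
    (σ : Equiv.Perm (Fin (n + 1))) (hσ : σ ≠ 1) :
    Filter.Tendsto (fun N : ℕ => (∏ b, ‖l (σ b) b‖) *
      Real.exp (N * ∑ b, c b * (((σ b : ℕ) : ℝ) - ((b : ℕ) : ℝ)))) Filter.atTop (nhds 0) := by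
  have hv : Monotone (fun b : Fin (n + 1) => ((b : ℕ) : ℝ)) := by
    intro a b h
    simpa using h
  have hmv := hc.monovary hv
  have hle := hmv.sum_mul_comp_perm_le_sum_mul (σ := σ)
  rcases hle.lt_or_eq with h | h
  · have hK : ∑ b, c b * (((σ b : ℕ) : ℝ) - ((b : ℕ) : ℝ)) < 0 := by
      simp only [mul_sub, Finset.sum_sub_distrib]
      linarith
    have h1 : Filter.Tendsto (fun N : ℕ => Real.exp (N * ∑ b, c b * (((σ b : ℕ) : ℝ) - ((b : ℕ) : ℝ))))
        Filter.atTop (nhds 0) :=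
      Real.tendsto_exp_atBot.comp (tendsto_natCast_atTop_atTop.atTop_mul_const_of_neg hK)
    simpa using h1.const_mul (∏ b, ‖l (σ b) b‖)
  · rw [hmv.sum_mul_comp_perm_eq_sum_mul_iff] at h
    have hm : Monotone (c ∘ (σ⁻¹ : Equiv.Perm (Fin (n + 1)))) := by
      intro a b hab
      rcases hab.lt_or_eq with hlt | rfl
      · apply h
        simpa using hlt
      · exact le_rfl
    have heq : c ∘ (σ⁻¹ : Equiv.Perm (Fin (n + 1))) = c ∘ (1 : Equiv.Perm (Fin (n + 1))) :=
      Tuple.unique_monotone hm (by simpa using hc)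
    obtain ⟨b, hb⟩ : ∃ b, σ b ≠ b := by
      by_contra! hcon
      exact hσ (Equiv.ext hcon)
    have hl : l (σ b) b = 0 := by
      apply hzero _ _ hb
      have := congrFun heq (σ b)
      simpa using this.symm
    have h0 : (∏ b, ‖l (σ b) b‖) = 0 :=
      Finset.prod_eq_zero (Finset.mem_univ b) (by simp [hl])
    simp [h0]

theorem aux_bound {n : ℕ} (c : Fin (n + 1) → ℝ) (hc : Monotone c) (N : ℕ)
    (i : Fin (n + 1) → ℕ) (hi : StrictMono i)
    (hN : ∀ j : Fin n, N ≤ i j.succ - i j.castSucc) (σ : Equiv.Perm (Fin (n + 1))) :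
    ∑ b, c b * ((i (σ b) : ℝ) - (i b : ℝ)) ≤
      N * ∑ b, c b * (((σ b : ℕ) : ℝ) - ((b : ℕ) : ℝ)) := by
  have hm : Monotone (fun b : Fin (n + 1) => (i b : ℝ) - N * ((b : ℕ) : ℝ)) := by
    rw [Fin.monotone_iff_le_succ]
    intro j
    have h1 := hN j
    have h2 : i j.castSucc < i j.succ := hi j.castSucc_lt_succ
    have h3 : N + i j.castSucc ≤ i j.succ := by omega
    have h4 : (N : ℝ) + i j.castSucc ≤ i j.succ := by exact_mod_cast h3
    simp only [Fin.val_castSucc, Fin.val_succ]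
    push_cast
    linarith
  have h := (hc.monovary hm).sum_mul_comp_perm_le_sum_mul (σ := σ)
  have e : ∑ b, c b * ((i (σ b) : ℝ) - (i b : ℝ)) -
      N * ∑ b, c b * (((σ b : ℕ) : ℝ) - ((b : ℕ) : ℝ)) =
      ∑ b, c b * ((i (σ b) : ℝ) - N * ((σ b : ℕ) : ℝ)) -
      ∑ b, c b * ((i b : ℝ) - N * ((b : ℕ) : ℝ)) := by
    rw [Finset.mul_sum, ← Finset.sum_sub_distrib, ← Finset.sum_sub_distrib]
    apply Finset.sum_congr rfl
    intros
    ring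
  linarith

/-- the determinant `D(i₁,…,i_n) = det (l_{a,b} λ_b^{−i_a})` is asymptotic to
`∏_b λ_b^{−i_b}` as all the gaps `Δi_j` tend to infinity. -/
theorem stmt10 {n : ℕ} (d : Fin (n + 1) → ℂ) (hd0 : ∀ b, d b ≠ 0)
    (hsort : ∀ a b : Fin (n + 1), a ≤ b → ‖d b‖ ≤ ‖d a‖)
    (l : Fin (n + 1) → Fin (n + 1) → ℂ)
    (hdiag : ∀ a, l a a = 1)
    (hzero : ∀ a b, a ≠ b → ‖d a‖ = ‖d b‖ → l a b = 0) :
    ∀ ε : ℝ, 0 < ε → ∃ N : ℕ, ∀ i : Fin (n + 1) → ℕ,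
      StrictMono i → 1 ≤ i 0 →
      (∀ j : Fin (n + 1),
        N ≤ Fin.cases (i 0) (fun j' : Fin n => i j'.succ - i j'.castSucc) j) →
      ‖((Matrix.of fun a b : Fin (n + 1) => l a b * d b ^ (-(i a : ℤ))).det /
          (∏ b : Fin (n + 1), d b ^ (-(i b : ℤ))) - 1)‖ < ε := by
  intro ε hε
  set c : Fin (n + 1) → ℝ := fun b => - Real.log ‖d b‖ with hcdef
  have hpos : ∀ b, 0 < ‖d b‖ := fun b => norm_pos_iff.2 (hd0 b)
  have hc : Monotone c := fun a b hab =>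
    neg_le_neg (Real.log_le_log (hpos b) (hsort a b hab))
  have hz : ∀ a b, a ≠ b → c a = c b → l a b = 0 := fun a b hab h =>
    hzero a b hab (Real.log_injOn_pos (hpos a) (hpos b) (neg_injective h))
  have hnorm : ∀ (b : Fin (n + 1)) (k : ℕ), ‖d b ^ (-(k : ℤ))‖ = Real.exp (c b * k) := by
    intro b k
    rw [norm_zpow, ← Real.rpow_intCast, Real.rpow_def_of_pos (hpos b)]
    congr 1
    simp [hcdef]
  have hT : Filter.Tendsto (fun N : ℕ => ∑ σ ∈ Finset.univ.erase (1 : Equiv.Perm (Fin (n + 1))),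
      (∏ b, ‖l (σ b) b‖) *
      Real.exp (N * ∑ b, c b * (((σ b : ℕ) : ℝ) - ((b : ℕ) : ℝ)))) Filter.atTop (nhds 0) := by
    have := tendsto_finsetSum (Finset.univ.erase (1 : Equiv.Perm (Fin (n + 1))))
      (fun σ hσ => aux_tendsto c hc l hz σ (Finset.ne_of_mem_erase hσ))
    simpa using this
  obtain ⟨N, hNε⟩ := (hT.eventually (gt_mem_nhds hε)).exists
  refine ⟨N, fun i hi _ hgap => lt_of_le_of_lt ?_ hNε⟩
  have hN : ∀ j : Fin n, N ≤ i j.succ - i j.castSucc := fun j => by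
    simpa using hgap j.succ
  have hP : (∏ b : Fin (n + 1), d b ^ (-(i b : ℤ))) ≠ 0 :=
    Finset.prod_ne_zero_iff.2 fun b _ => zpow_ne_zero _ (hd0 b)
  rw [Matrix.det_apply', Finset.sum_div,
    ← Finset.add_sum_erase _ _ (Finset.mem_univ (1 : Equiv.Perm (Fin (n + 1))))]
  have h1 : ((Equiv.Perm.sign (1 : Equiv.Perm (Fin (n + 1))) : ℤ) : ℂ) *
      (∏ b, (Matrix.of fun a b : Fin (n + 1) => l a b * d b ^ (-(i a : ℤ)))
        ((1 : Equiv.Perm (Fin (n + 1))) b) b) /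
      (∏ b : Fin (n + 1), d b ^ (-(i b : ℤ))) = 1 := by
    rw [div_eq_one_iff_eq hP]
    simp [hdiag]
  rw [h1, add_sub_cancel_left]
  refine (norm_sum_le _ _).trans (Finset.sum_le_sum fun σ _ => ?_)
  have hs : ‖((Equiv.Perm.sign σ : ℤ) : ℂ)‖ = 1 := by
    rcases Int.units_eq_one_or (Equiv.Perm.sign σ) with h | h <;> simp [h]
  have e : ‖((Equiv.Perm.sign σ : ℤ) : ℂ) *
      (∏ b, (Matrix.of fun a b : Fin (n + 1) => l a b * d b ^ (-(i a : ℤ))) (σ b) b) /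
      (∏ b : Fin (n + 1), d b ^ (-(i b : ℤ)))‖ =
      (∏ b, ‖l (σ b) b‖) * Real.exp (∑ b, c b * ((i (σ b) : ℝ) - (i b : ℝ))) := by
    rw [norm_div, norm_mul, hs, one_mul, norm_prod, norm_prod]
    simp only [Matrix.of_apply, norm_mul, hnorm, Finset.prod_mul_distrib, ← Real.exp_sum]
    rw [mul_div_assoc, ← Real.exp_sub, ← Finset.sum_sub_distrib]
    simp only [mul_sub]
  rw [e]
  exact mul_le_mul_of_nonneg_left (Real.exp_le_exp.2 (aux_bound c hc N i hi hN σ))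
    (Finset.prod_nonneg fun _ _ => norm_nonneg _)
end

section
/- Let A = diag(λ₁,…,λ_n) with |λ₁| ≥ … ≥ |λ_n| > 1 and let C ∈ ℂ^{m×n}. Assume non-degeneracy: for every equi-modulus index set I = {j : |λ_j| = r} the submatrix of the columns of C indexed by I has rank |I|. Then there exist a constant β > 0 and N ∈ ℕ such that for all positive integers i₁ < i₂ < … < i_n with Δi₁ = i₁ ≥ N and Δi_j = i_j − i_{j−1} ≥ N for j = 2,…,n, the matrix S = Σ_{j=1}^n (A^{−i_j})* C* C A^{−i_j} is invertible and S⁻¹ ≤ β · (∏_{j=1}^n |λ_j|^{2Δi_j}) · I in the Loewner order. -/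
open Matrix MeasureTheory ProbabilityTheory
open scoped ComplexOrder ENNReal

lemma aux_dom (n : ℕ) (b : ℝ) (hb : 0 ≤ b) : ∃ ε : ℝ, 0 < ε ∧ ∃ c : ℝ, 0 < c ∧
    ∀ M : Matrix (Fin (n+1)) (Fin (n+1)) ℂ, (∀ j, M j j = 1) →
      (∀ j k, j < k → ‖M j k‖ ≤ b) → (∀ j k, k < j → ‖M j k‖ ≤ ε) →
      ∀ (w : Fin (n+1) → ℂ) (Y : ℝ), (∀ j, ‖∑ k, M j k * w k‖ ≤ Y) → ∀ k, ‖w k‖ ≤ c * Y := by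
  set t : ℝ := 1 / (4 * (n+1) * (b+1)) with ht
  have hn0 : (0:ℝ) ≤ n := Nat.cast_nonneg n
  have hden : 1 ≤ 4 * ((n:ℝ)+1) * (b+1) := by nlinarith [mul_nonneg hn0 hb]
  have htpos : 0 < t := by positivity
  have ht1 : t ≤ 1 := by rw [ht, div_le_one (by positivity)]; exact hden
  have hbt : b * t ≤ 1 / (4 * (n+1)) := by
    rw [ht, mul_one_div, div_le_div_iff₀ (by positivity) (by positivity)]
    nlinarith [mul_nonneg hn0 hb]
  refine ⟨t ^ n / (4 * (n+1)), by positivity, 2 / t ^ n, by positivity, ?_⟩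
  intro M hd hu hl w Y hY
  obtain ⟨k0, -, hk0⟩ := Finset.exists_max_image (Finset.univ : Finset (Fin (n+1)))
    (fun k => ‖w k‖ / t ^ (k:ℕ)) ⟨0, Finset.mem_univ _⟩
  set V := ‖w k0‖ / t ^ (k0:ℕ) with hV
  have hV0 : 0 ≤ V := by positivity
  have hw0 : ‖w k0‖ = t ^ (k0:ℕ) * V := by rw [hV]; field_simp
  have hw : ∀ k, ‖w k‖ ≤ t ^ (k:ℕ) * V := by
    intro k
    have := hk0 k (Finset.mem_univ _)
    rw [div_le_iff₀ (by positivity)] at this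
    linarith
  have htn : t ^ n ≤ t ^ (k0:ℕ) := pow_le_pow_of_le_one htpos.le ht1 (by omega)
  have hterm : ∀ k ∈ Finset.univ.erase k0, ‖M k0 k * w k‖ ≤ 1 / (4 * (n+1)) * (t ^ (k0:ℕ) * V) := by
    intro k hk
    have hne := Finset.ne_of_mem_erase hk
    rw [norm_mul]
    rcases lt_or_gt_of_ne hne with h | h
    · have h1 := hl k0 k h
      have h2 : ‖w k‖ ≤ V := (hw k).trans
        (mul_le_of_le_one_left hV0 (pow_le_one₀ htpos.le ht1))
      calc _ ≤ t ^ n / (4 * (n+1)) * V := mul_le_mul h1 h2 (norm_nonneg _) (by positivity)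
        _ ≤ t ^ (k0:ℕ) / (4 * (n+1)) * V := by gcongr
        _ = _ := by ring
    · have h1 := hu k0 k h
      have h3 : t ^ (k:ℕ) ≤ t * t ^ (k0:ℕ) := by
        rw [← pow_succ']
        exact pow_le_pow_of_le_one htpos.le ht1 h
      calc _ ≤ b * (t ^ (k:ℕ) * V) := mul_le_mul h1 (hw k) (norm_nonneg _) hb
        _ ≤ b * (t * t ^ (k0:ℕ) * V) := by gcongr
        _ = (b * t) * (t ^ (k0:ℕ) * V) := by ring
        _ ≤ _ := by gcongr
  have hsum : ‖∑ k ∈ Finset.univ.erase k0, M k0 k * w k‖ ≤ 1/4 * (t ^ (k0:ℕ) * V) := by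
    refine (norm_sum_le _ _).trans ((Finset.sum_le_card_nsmul _ _ _ hterm).trans ?_)
    rw [Finset.card_erase_of_mem (Finset.mem_univ _), Finset.card_univ, Fintype.card_fin, nsmul_eq_mul,
      Nat.add_sub_cancel, ← mul_assoc]
    gcongr
    rw [mul_one_div, div_le_div_iff₀ (by positivity) (by positivity)]
    linarith
  have hrow := hY k0
  rw [← Finset.add_sum_erase _ _ (Finset.mem_univ k0), hd, one_mul] at hrow
  have h5 : ‖w k0‖ ≤ Y + 1/4 * (t ^ (k0:ℕ) * V) := by
    have := norm_sub_le (w k0 + ∑ k ∈ Finset.univ.erase k0, M k0 k * w k) (∑ k ∈ Finset.univ.erase k0, M k0 k * w k)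
    rw [add_sub_cancel_right] at this
    linarith
  rw [hw0] at h5
  have hA : 0 ≤ t ^ (k0:ℕ) * V := by positivity
  have h6 : t ^ (k0:ℕ) * V ≤ 2 * Y := by linarith
  intro k
  have h7 : ‖w k‖ ≤ V := (hw k).trans (mul_le_of_le_one_left hV0 (pow_le_one₀ htpos.le ht1))
  refine h7.trans ?_
  rw [div_mul_eq_mul_div, le_div_iff₀ (by positivity)]
  have : V * t ^ n ≤ t ^ (k0:ℕ) * V := by rw [mul_comm]; gcongr
  linarith

lemma aux_rows {n m : ℕ} (d : Fin (n + 1) → ℂ) (C : Matrix (Fin m) (Fin (n + 1)) ℂ)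
    (hnd : NonDeg d C) (j : Fin (n+1)) : ∃ u : Fin m → ℂ,
      ∀ k, ‖d k‖ = ‖d j‖ → ∑ i, u i * C i k = if k = j then 1 else 0 := by
  have h := hnd ‖d j‖
  obtain ⟨g, hg⟩ := LinearMap.exists_leftInverse_of_injective _
    (LinearMap.ker_eq_bot.2 (linearIndependent_iff_injective_fintypeLinearCombination.1 h))
  refine ⟨fun i => g (Pi.single i 1) ⟨j, rfl⟩, fun k hk => ?_⟩
  have h1 := LinearMap.congr_fun hg (Pi.single ⟨k, hk⟩ 1)
  rw [LinearMap.comp_apply, Fintype.linearCombination_apply_single, one_smul,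
    LinearMap.pi_apply_eq_sum_univ g] at h1
  have h2 := congrFun h1 ⟨j, rfl⟩
  simp only [Finset.sum_apply, Pi.smul_apply, smul_eq_mul, LinearMap.id_apply, Pi.single_apply,
    Subtype.mk.injEq] at h2
  simp only [eq_comm (a := k) (b := j)]
  rw [← h2]
  refine Finset.sum_congr rfl fun i _ => ?_
  have e : (Pi.single i 1 : Fin m → ℂ) = fun j => if i = j then 1 else 0 := by
    ext a
    simp [Pi.single_apply, eq_comm]
  rw [mul_comm, ← e]

lemma aux_loe {n m : ℕ} (G : Fin (n+1) → Matrix (Fin m) (Fin (n + 1)) ℂ) (κ : ℝ) (hκ : 0 < κ)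
    (h : ∀ x : Fin (n+1) → ℂ, ∑ k, ‖x k‖ ^ 2 ≤ κ * ∑ j, ∑ i, ‖(G j *ᵥ x) i‖ ^ 2) :
    IsUnit (∑ j, (G j)ᴴ * G j) ∧
      loe ((∑ j, (G j)ᴴ * G j)⁻¹) ((κ : ℂ) • (1 : Matrix (Fin (n + 1)) (Fin (n + 1)) ℂ)) := by
  set S := ∑ j, (G j)ᴴ * G j with hS
  have nsq : ∀ {p : ℕ} (v : Fin p → ℂ), star v ⬝ᵥ v = ((∑ k, ‖v k‖ ^ 2 : ℝ) : ℂ) := by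
    intro p v
    simp only [dotProduct, Pi.star_apply, Complex.ofReal_sum]
    refine Finset.sum_congr rfl fun k _ => ?_
    rw [RCLike.star_def, Complex.conj_mul']
    push_cast; rfl
  have hSh : S.IsHermitian := by
    rw [hS]; unfold IsHermitian
    simp [conjTranspose_sum, conjTranspose_mul]
  have hSx : ∀ x, star x ⬝ᵥ (S *ᵥ x) = ((∑ j, ∑ i, ‖(G j *ᵥ x) i‖ ^ 2 : ℝ) : ℂ) := by
    intro x
    rw [hS, Matrix.sum_mulVec, dotProduct_sum, Complex.ofReal_sum]
    refine Finset.sum_congr rfl fun j _ => ?_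
    rw [← nsq, ← mulVec_mulVec, dotProduct_mulVec, ← star_mulVec]
  have hT0 : (S - ((κ⁻¹ : ℝ) : ℂ) • (1 : Matrix (Fin (n + 1)) (Fin (n + 1)) ℂ)).PosSemidef := by
    refine PosSemidef.of_dotProduct_mulVec_nonneg ?_ ?_
    · refine hSh.sub ?_
      unfold IsHermitian
      rw [conjTranspose_smul, conjTranspose_one]; simp
    · intro x
      rw [sub_mulVec, dotProduct_sub, hSx, smul_mulVec, one_mulVec, dotProduct_smul, nsq, smul_eq_mul,
        ← Complex.ofReal_mul, ← Complex.ofReal_sub, Complex.zero_le_real, sub_nonneg,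
        inv_mul_le_iff₀ hκ]
      exact h x
  have h1 : (((κ⁻¹ : ℝ) : ℂ) • (1 : Matrix (Fin (n + 1)) (Fin (n + 1)) ℂ)).PosDef := by
    refine PosDef.one.smul ?_
    exact Complex.zero_lt_real.2 (inv_pos.2 hκ)
  have hSp : S.PosDef := by
    have := h1.add_posSemidef hT0
    simpa using this
  have hu := hSp.isUnit
  refine ⟨hu, ?_⟩
  unfold loe
  have hTh : S⁻¹ᴴ = S⁻¹ := hSh.inv
  have hST : S⁻¹ * S = 1 := nonsing_inv_mul _ ((Matrix.isUnit_iff_isUnit_det _).1 hu)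
  have hTp := hT0.conjTranspose_mul_mul_same S⁻¹
  have hq := (posSemidef_conjTranspose_mul_self
    ((κ : ℂ) • (1 : Matrix (Fin (n + 1)) (Fin (n + 1)) ℂ) - S⁻¹)).smul
    (a := ((κ⁻¹ : ℝ) : ℂ)) (Complex.zero_le_real.2 (inv_pos.2 hκ).le)
  convert hTp.add hq using 1
  have hκc : (κ:ℂ) ≠ 0 := by exact_mod_cast hκ.ne'
  rw [conjTranspose_sub, conjTranspose_smul, conjTranspose_one, hTh]
  simp only [mul_sub, sub_mul, hST, one_mul, mul_one, smul_mul_assoc, mul_smul_comm, smul_sub,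
    smul_smul, Complex.ofReal_inv, RCLike.star_def, Complex.conj_ofReal, inv_mul_cancel₀ hκc,
    inv_mul_cancel_left₀ hκc, one_smul]
  abel

lemma aux_sum {n : ℕ} (i : Fin (n+1) → ℕ) (hi : StrictMono i) (Δ : Fin (n+1) → ℕ)
    (h0 : Δ 0 = i 0) (hs : ∀ j : Fin n, Δ j.succ = i j.succ - i j.castSucc) (k : Fin (n+1)) :
    i k = ∑ l ∈ Finset.Iic k, Δ l := by
  induction k using Fin.induction with
  | zero =>
    have : Finset.Iic (0 : Fin (n+1)) = {0} := by ext a; simp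
    simp [this, h0]
  | succ k ih =>
    have : Finset.Iic k.succ = insert k.succ (Finset.Iic k.castSucc) := by
      ext a; simp [Fin.le_def, Fin.ext_iff]; omega
    rw [this, Finset.sum_insert (by simp [Fin.le_def]), ← ih, hs]
    have := hi (Fin.castSucc_lt_succ (i := k))
    omega

lemma aux_split {n : ℕ} (j k : Fin (n+1)) (h : j ≤ k) :
    Finset.Iic k = Finset.Iic j ∪ Finset.Ioc j k ∧ Disjoint (Finset.Iic j) (Finset.Ioc j k) := by
  constructor
  · ext a; rw [Fin.le_def] at h; simp only [Finset.mem_Iic, Finset.mem_union, Finset.mem_Ioc, Fin.le_def, Fin.lt_def]; omega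
  · rw [Finset.disjoint_left]; intro a; simp only [Finset.mem_Iic, Finset.mem_Ioc, Fin.le_def, Fin.lt_def]; omega

lemma aux_inv {n : ℕ} (d : Fin (n+1) → ℂ) (hd : ∀ k, d k ≠ 0) (p : ℕ) :
    (Matrix.diagonal d)⁻¹ ^ p = Matrix.diagonal (fun k => (d k ^ p)⁻¹) := by
  have : (Matrix.diagonal d)⁻¹ = Matrix.diagonal (fun k => (d k)⁻¹) := by
    apply Matrix.inv_eq_right_inv
    rw [diagonal_mul_diagonal, ← diagonal_one]
    congr 1; ext k; simp [hd k]
  rw [this, diagonal_pow]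
  congr 1; ext k; simp

lemma aux_main {n m : ℕ} (d : Fin (n + 1) → ℂ) (C : Matrix (Fin m) (Fin (n + 1)) ℂ)
    (hsort : ∀ a b : Fin (n + 1), a ≤ b → ‖d b‖ ≤ ‖d a‖)
    (hunst : ∀ a, 1 < ‖d a‖)
    (hnd : NonDeg d C) :
    ∃ β : ℝ, 0 < β ∧ ∃ N : ℕ, ∀ i Δ : Fin (n + 1) → ℕ,
      (∀ k, i k = ∑ l ∈ Finset.Iic k, Δ l) → (∀ j, N ≤ Δ j) →
      ∀ x : Fin (n+1) → ℂ, ∑ k, ‖x k‖ ^ 2 ≤ (β * ∏ j, ‖d j‖ ^ (2 * Δ j)) *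
        ∑ j, ∑ a, ‖((C * (Matrix.diagonal d)⁻¹ ^ i j) *ᵥ x) a‖ ^ 2 := by
  have hd0 : ∀ k, d k ≠ 0 := fun k => norm_pos_iff.1 (zero_lt_one.trans (hunst k))
  have hr0 : ∀ k, 0 < ‖d k‖ := fun k => norm_pos_iff.2 (hd0 k)
  choose u hu using aux_rows d C hnd
  set B : Fin (n+1) → Fin (n+1) → ℂ := fun j k => ∑ a, u j a * C a k with hB
  set b : ℝ := ∑ j, ∑ k, ‖B j k‖ with hb
  have hb0 : 0 ≤ b := by positivity
  have hBb : ∀ j k, ‖B j k‖ ≤ b := fun j k =>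
    (Finset.single_le_sum (f := fun k => ‖B j k‖) (fun _ _ => norm_nonneg _) (Finset.mem_univ k)).trans
    (Finset.single_le_sum (f := fun j => ∑ k, ‖B j k‖) (fun _ _ => by positivity) (Finset.mem_univ j))
  obtain ⟨ε, hε, c, hc, hdom⟩ := aux_dom n b hb0
  set K : ℝ := 1 + ∑ j, ∑ a, ‖u j a‖ ^ 2 with hK
  have hK0 : 0 < K := by positivity
  have hev : ∀ᶠ N : ℕ in Filter.atTop, ∀ j k, ‖d j‖ < ‖d k‖ → b * (‖d j‖ / ‖d k‖) ^ N ≤ ε := by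
    simp only [Filter.eventually_all]
    intro j k hjk
    have := (tendsto_pow_atTop_nhds_zero_of_lt_one (r := ‖d j‖ / ‖d k‖) (by positivity)
      ((div_lt_one (hr0 k)).2 hjk)).const_mul b
    rw [mul_zero] at this
    exact this.eventually_le_const hε
  obtain ⟨N, hN⟩ := hev.exists
  refine ⟨(n+1) * c ^ 2 * K, by positivity, N, ?_⟩
  intro i Δ hi hΔ x
  set ρ : Fin (n+1) → ℝ := fun k => ∏ l ∈ Finset.Iic k, ‖d l‖ ^ Δ l with hρ
  have hρ0 : ∀ k, 0 < ρ k := fun k => Finset.prod_pos fun l _ => pow_pos (hr0 l) _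
  set P : ℝ := ∏ l, ‖d l‖ ^ Δ l with hP
  have hρP : ∀ k, ρ k ≤ P := fun k =>
    Finset.prod_le_prod_of_subset_of_one_le (Finset.subset_univ _)
      (fun l _ => by positivity) (fun l _ _ => one_le_pow₀ (hunst l).le)
  have hP0 : 0 < P := (hρ0 0).trans_le (hρP 0)
  have hia : ∀ k, ‖d k‖ ^ i k ≤ ρ k := by
    intro k
    rw [hi, ← Finset.prod_pow_eq_pow_sum]
    refine Finset.prod_le_prod (fun _ _ => by positivity) fun l hl => ?_
    exact pow_le_pow_left₀ (hr0 k).le (hsort _ _ (Finset.mem_Iic.1 hl)) _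
  have hib : ∀ j k, j < k → ρ j * ‖d k‖ ^ i k ≤ ρ k * ‖d k‖ ^ i j := by
    intro j k hjk
    obtain ⟨h1, h2⟩ := aux_split j k hjk.le
    have e1 : i k = i j + ∑ l ∈ Finset.Ioc j k, Δ l := by
      rw [hi, hi, h1, Finset.sum_union h2]
    have e2 : ρ k = ρ j * ∏ l ∈ Finset.Ioc j k, ‖d l‖ ^ Δ l := by
      simp only [hρ]; rw [h1, Finset.prod_union h2]
    have e3 : ‖d k‖ ^ (∑ l ∈ Finset.Ioc j k, Δ l) ≤ ∏ l ∈ Finset.Ioc j k, ‖d l‖ ^ Δ l := by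
      rw [← Finset.prod_pow_eq_pow_sum]
      refine Finset.prod_le_prod (fun _ _ => by positivity) fun l hl => ?_
      exact pow_le_pow_left₀ (hr0 k).le (hsort _ _ (Finset.mem_Ioc.1 hl).2) _
    rw [e1, e2, pow_add]
    have := hρ0 j
    calc _ = ρ j * ‖d k‖ ^ i j * ‖d k‖ ^ (∑ l ∈ Finset.Ioc j k, Δ l) := by ring
      _ ≤ ρ j * ‖d k‖ ^ i j * ∏ l ∈ Finset.Ioc j k, ‖d l‖ ^ Δ l := by gcongr
      _ = _ := by ring
  have hic : ∀ j k, k < j → ‖d j‖ < ‖d k‖ →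
      ρ j * ‖d k‖ ^ i k ≤ (‖d j‖ / ‖d k‖) ^ N * (ρ k * ‖d k‖ ^ i j) := by
    intro j k hjk hlt
    obtain ⟨h1, h2⟩ := aux_split k j hjk.le
    have e1 : i j = i k + ∑ l ∈ Finset.Ioc k j, Δ l := by
      rw [hi, hi, h1, Finset.sum_union h2]
    have e2 : ρ j = ρ k * ∏ l ∈ Finset.Ioc k j, ‖d l‖ ^ Δ l := by
      simp only [hρ]; rw [h1, Finset.prod_union h2]
    have hmem : j ∈ Finset.Ioc k j := Finset.mem_Ioc.2 ⟨hjk, le_rfl⟩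
    have e3 : ∏ l ∈ Finset.Ioc k j, ‖d l‖ ^ Δ l ≤
        (‖d j‖ / ‖d k‖) ^ N * ‖d k‖ ^ (∑ l ∈ Finset.Ioc k j, Δ l) := by
      rw [← Finset.prod_pow_eq_pow_sum, ← Finset.mul_prod_erase _ _ hmem,
        ← Finset.mul_prod_erase _ (fun l => ‖d k‖ ^ Δ l) hmem, ← mul_assoc]
      refine mul_le_mul ?_ ?_ (by positivity) (by positivity)
      · calc ‖d j‖ ^ Δ j = (‖d j‖ / ‖d k‖) ^ Δ j * ‖d k‖ ^ Δ j := by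
              rw [← mul_pow, div_mul_cancel₀ _ (hr0 k).ne']
          _ ≤ _ := by
              gcongr ?_ * _
              exact pow_le_pow_of_le_one (by positivity) ((div_le_one (hr0 k)).2 hlt.le) (hΔ j)
      · refine Finset.prod_le_prod (fun _ _ => by positivity) fun l hl => ?_
        exact pow_le_pow_left₀ (hr0 l).le
          (hsort _ _ (Finset.mem_Ioc.1 (Finset.mem_of_mem_erase hl)).1.le) _
    rw [e1, e2, pow_add]
    have := hρ0 k
    calc _ = ρ k * ‖d k‖ ^ i k * ∏ l ∈ Finset.Ioc k j, ‖d l‖ ^ Δ l := by ring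
      _ ≤ ρ k * ‖d k‖ ^ i k * ((‖d j‖ / ‖d k‖) ^ N * ‖d k‖ ^ (∑ l ∈ Finset.Ioc k j, Δ l)) := by gcongr
      _ = _ := by ring
  set Q : ℝ := ∑ j, ∑ a, ‖((C * (Matrix.diagonal d)⁻¹ ^ i j) *ᵥ x) a‖ ^ 2 with hQ
  have hQ0 : 0 ≤ Q := by positivity
  -- the scalar outputs
  have hy : ∀ j, ∑ a, u j a * ((C * (Matrix.diagonal d)⁻¹ ^ i j) *ᵥ x) a
      = ∑ k, B j k * ((d k ^ i j)⁻¹ * x k) := by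
    intro j
    rw [aux_inv d hd0]
    simp only [hB, mulVec, dotProduct, mul_diagonal, Finset.mul_sum, Finset.sum_mul]
    rw [Finset.sum_comm]
    refine Finset.sum_congr rfl fun k _ => Finset.sum_congr rfl fun a _ => ?_
    ring
  have hyb : ∀ j, ‖∑ a, u j a * ((C * (Matrix.diagonal d)⁻¹ ^ i j) *ᵥ x) a‖ ≤ √(K * Q) := by
    intro j
    apply Real.le_sqrt_of_sq_le
    calc _ ≤ (∑ a, ‖u j a‖ * ‖((C * (Matrix.diagonal d)⁻¹ ^ i j) *ᵥ x) a‖) ^ 2 := by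
            gcongr
            exact (norm_sum_le _ _).trans_eq (by simp only [norm_mul])
      _ ≤ (∑ a, ‖u j a‖ ^ 2) * ∑ a, ‖((C * (Matrix.diagonal d)⁻¹ ^ i j) *ᵥ x) a‖ ^ 2 :=
            Finset.sum_mul_sq_le_sq_mul_sq _ _ _
      _ ≤ K * Q := by
            refine mul_le_mul ?_ ?_ (by positivity) hK0.le
            · have := Finset.single_le_sum (f := fun j => ∑ a, ‖u j a‖ ^ 2)
                (fun _ _ => by positivity) (Finset.mem_univ j)
              linarith
            · exact Finset.single_le_sum
                (f := fun j => ∑ a, ‖((C * (Matrix.diagonal d)⁻¹ ^ i j) *ᵥ x) a‖ ^ 2)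
                (fun _ _ => by positivity) (Finset.mem_univ j)
  have hρc : ∀ k, (ρ k : ℂ) ≠ 0 := fun k => by exact_mod_cast (hρ0 k).ne'
  have hnorm : ∀ j k, ‖(ρ j : ℂ) * B j k * (d k ^ i j)⁻¹ * d k ^ i k / ρ k‖
      = ‖B j k‖ * (ρ j * ‖d k‖ ^ i k / (ρ k * ‖d k‖ ^ i j)) := by
    intro j k
    have := hr0 k
    have := hρ0 k
    simp only [norm_mul, norm_div, norm_inv, norm_pow, Complex.norm_real, Real.norm_eq_abs,
      abs_of_pos (hρ0 _)]
    field_simp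
  have hw := hdom (Matrix.of fun j k => (ρ j : ℂ) * B j k * (d k ^ i j)⁻¹ * d k ^ i k / ρ k)
    ?_ ?_ ?_ (fun k => ρ k * (d k ^ i k)⁻¹ * x k) (P * √(K * Q)) ?_
  · have hx : ∀ k, ‖x k‖ ≤ c * (P * √(K * Q)) := by
      intro k
      refine le_trans ?_ (hw k)
      simp only [norm_mul, norm_inv, norm_pow, Complex.norm_real, Real.norm_eq_abs,
        abs_of_pos (hρ0 _)]
      refine le_mul_of_one_le_left (norm_nonneg _) ?_
      rw [← div_eq_mul_inv, one_le_div (pow_pos (hr0 k) _)]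
      exact hia k
    calc ∑ k, ‖x k‖ ^ 2 ≤ ∑ k : Fin (n+1), (c * (P * √(K * Q))) ^ 2 := by
          gcongr with k
          exact hx k
      _ = (n+1) * (c ^ 2 * (P ^ 2 * (√(K * Q)) ^ 2)) := by simp [mul_pow]
      _ = _ := by
          rw [Real.sq_sqrt (by positivity), hP, ← Finset.prod_pow]
          simp only [← pow_mul, mul_comm 2]
          ring
  · intro j
    have h1 : B j j = 1 := by simp only [hB]; rw [hu j j rfl]; simp
    simp only [Matrix.of_apply, h1]
    have := hd0 j
    have := hρc j
    field_simp
  · intro j k hjk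
    rw [Matrix.of_apply, hnorm]
    have := hr0 k
    have := hρ0 k
    refine (mul_le_of_le_one_right (norm_nonneg _) ?_).trans (hBb j k)
    rw [div_le_one (by positivity)]
    exact hib j k hjk
  · intro j k hjk
    rw [Matrix.of_apply, hnorm]
    rcases (hsort k j hjk.le).eq_or_lt with h | h
    · have : B j k = 0 := by simp only [hB]; rw [hu j k h.symm]; simp [hjk.ne]
      rw [this]; simpa using hε.le
    · have := hr0 k
      have := hρ0 k
      refine le_trans ?_ (hN j k h)
      refine mul_le_mul (hBb j k) ?_ (by have := hρ0 j; positivity) hb0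
      rw [div_le_iff₀ (by positivity)]
      exact hic j k hjk h
  · intro j
    have : ∑ k, (Matrix.of fun j k => (ρ j : ℂ) * B j k * (d k ^ i j)⁻¹ * d k ^ i k / ρ k) j k *
        (ρ k * (d k ^ i k)⁻¹ * x k) = ρ j * ∑ k, B j k * ((d k ^ i j)⁻¹ * x k) := by
      rw [Finset.mul_sum]
      refine Finset.sum_congr rfl fun k _ => ?_
      rw [Matrix.of_apply]
      have := hd0 k
      have := hρc k
      field_simp
    rw [this, ← hy, norm_mul, Complex.norm_real, Real.norm_eq_abs, abs_of_pos (hρ0 _)]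
    exact mul_le_mul (hρP j) (hyb j) (norm_nonneg _) hP0.le

/-- for a non-degenerate system with all eigenvalues unstable there are `β > 0`
and `N` such that whenever all gaps `Δi_j ≥ N`, the matrix
`S = Σ_j (A^{−i_j})ᴴ Cᴴ C A^{−i_j}` is invertible and
`S⁻¹ ≤ β ∏_j |λ_j|^{2Δi_j} I`. -/
theorem stmt11 {n m : ℕ} (d : Fin (n + 1) → ℂ) (C : Matrix (Fin m) (Fin (n + 1)) ℂ)
    (hsort : ∀ a b : Fin (n + 1), a ≤ b → ‖d b‖ ≤ ‖d a‖)
    (hunst : ∀ a, 1 < ‖d a‖)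
    (hnd : NonDeg d C) :
    ∃ β : ℝ, 0 < β ∧ ∃ N : ℕ, ∀ i : Fin (n + 1) → ℕ,
      StrictMono i → 1 ≤ i 0 →
      (∀ j : Fin (n + 1),
        N ≤ Fin.cases (i 0) (fun j' : Fin n => i j'.succ - i j'.castSucc) j) →
      IsUnit (∑ j : Fin (n + 1),
          ((Matrix.diagonal d)⁻¹ ^ i j)ᴴ * Cᴴ * C * (Matrix.diagonal d)⁻¹ ^ i j) ∧
      loe ((∑ j : Fin (n + 1),
          ((Matrix.diagonal d)⁻¹ ^ i j)ᴴ * Cᴴ * C * (Matrix.diagonal d)⁻¹ ^ i j)⁻¹)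
        (((β * ∏ j : Fin (n + 1), ‖d j‖ ^
            (2 * Fin.cases (i 0) (fun j' : Fin n => i j'.succ - i j'.castSucc) j) : ℝ) : ℂ) •
          (1 : Matrix (Fin (n + 1)) (Fin (n + 1)) ℂ)) := by
  obtain ⟨β, hβ, N, h⟩ := aux_main d C hsort hunst hnd
  refine ⟨β, hβ, N, fun i hi _ hΔ => ?_⟩
  have key := h i _ (aux_sum i hi
    (fun j => Fin.cases (i 0) (fun j' : Fin n => i j'.succ - i j'.castSucc) j) rfl (fun _ => rfl)) hΔ
  have hpos : 0 < β * ∏ j : Fin (n + 1), ‖d j‖ ^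
            (2 * Fin.cases (motive := fun _ => ℕ) (i 0) (fun j' : Fin n => i j'.succ - i j'.castSucc) j) :=
    mul_pos hβ (Finset.prod_pos fun j _ => pow_pos (zero_lt_one.trans (hunst j)) _)
  have := aux_loe (fun j => C * (Matrix.diagonal d)⁻¹ ^ i j) _ hpos key
  simpa only [conjTranspose_mul, Matrix.mul_assoc] using this
end
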